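/- arXiv:1705.10102 — 2 statements merged into one kernel-verified Lean document; each statement's English description precedes it below -/
import Mathlib

section
/- Let A ∈ ℝ^{m×n} with spectral norm ‖A‖₂ ≤ 1, let β ∈ (0,1], and let p₁,…,p_n be probabilities with Σ_i p_i = 1 and p_i ≥ β ‖A_{*i}‖₂² / ‖A‖_F² for all i (where A_{*i} is the i-th column of A). Let W ∈ ℝ^{s×n} be the random sampling-and-rescaling matrix of Algorithm 1 built from these probabilities. Let δ ∈ (0,1) and ε > 0. If s ≥ 2(1 + ε/3) (‖A‖_F² / (β ε²)) ln(4(1 + ‖A‖_F²)/δ), then with probability at least 1 − δ, ‖A Wᵀ W Aᵀ − A Aᵀ‖₂ ≤ ε. -/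
open Matrix BigOperators

noncomputable def frobNorm {m n : Type*} [Fintype m] [Fintype n]
    (A : Matrix m n ℝ) : ℝ := Real.sqrt (∑ i, ∑ j, (A i j) ^ 2)

noncomputable def specNorm {m n : ℕ} (A : Matrix (Fin m) (Fin n) ℝ) : ℝ :=
  ‖LinearMap.toContinuousLinearMap (Matrix.toEuclideanLin A)‖

noncomputable def truncDiag {r : ℕ} (σ : Fin r → ℝ) (m : ℕ) :
    Matrix (Fin r) (Fin r) ℝ :=
  Matrix.diagonal fun i => if (i : ℕ) < m then σ i else 0

noncomputable def samplingMatrix {n : ℕ} (p : Fin n → ℝ) (s : ℕ) (ω : Fin s → Fin n) :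
    Matrix (Fin s) (Fin n) ℝ :=
  fun i j => if j = ω i then 1 / Real.sqrt (s * p j) else 0

noncomputable def expec {n s : ℕ} (p : Fin n → ℝ) (f : (Fin s → Fin n) → ℝ) : ℝ :=
  ∑ ω : Fin s → Fin n, (∏ i, p (ω i)) * f ω

open Classical in
noncomputable def probOf {n s : ℕ} (p : Fin n → ℝ) (E : (Fin s → Fin n) → Prop) : ℝ :=
  ∑ ω : Fin s → Fin n, if E ω then (∏ i, p (ω i)) else 0

def firstCols {n r : ℕ} (U : Matrix (Fin n) (Fin r) ℝ) (k : ℕ) (h : k ≤ r) :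
    Matrix (Fin n) (Fin k) ℝ :=
  fun i j => U i (Fin.castLE h j)

noncomputable def ridgeDiag {r : ℕ} (σ : Fin r → ℝ) (lam : ℝ) :
    Matrix (Fin r) (Fin r) ℝ :=
  Matrix.diagonal fun i => σ i / Real.sqrt (σ i ^ 2 + lam)

section Spectral

variable {ι : Type*} [Fintype ι] [DecidableEq ι]

theorem exists_orthogonal_diagonalization {M : Matrix ι ι ℝ} (hM : M.IsHermitian) :
    ∃ (U : Matrix ι ι ℝ) (d : ι → ℝ), Uᵀ * U = 1 ∧ U * Uᵀ = 1 ∧ M = U * diagonal d * Uᵀ := by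
  refine ⟨hM.eigenvectorUnitary, hM.eigenvalues, ?_, ?_, ?_⟩
  · simpa [star_eq_conjTranspose] using Unitary.coe_star_mul_self hM.eigenvectorUnitary
  · simpa [star_eq_conjTranspose] using Unitary.coe_mul_star_self hM.eigenvectorUnitary
  · simpa [Unitary.conjStarAlgAut_apply, star_eq_conjTranspose, Function.comp_def]
      using hM.spectral_theorem

theorem isHermitian_orthogonal_conj (U : Matrix ι ι ℝ) (d : ι → ℝ) :
    (U * diagonal d * Uᵀ).IsHermitian := by
  simp [IsHermitian, Matrix.mul_assoc]

theorem posSemidef_orthogonal_conj (U : Matrix ι ι ℝ) {d : ι → ℝ} (hd : ∀ i, 0 ≤ d i) :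
    (U * diagonal d * Uᵀ).PosSemidef := by
  simpa using (PosSemidef.diagonal (d := d) hd).mul_mul_conjTranspose_same U

theorem posSemidef_orthogonal_conj_iff {U : Matrix ι ι ℝ} (hU : Uᵀ * U = 1) {d : ι → ℝ} :
    (U * diagonal d * Uᵀ).PosSemidef ↔ ∀ i, 0 ≤ d i := by
  refine ⟨fun h => ?_, posSemidef_orthogonal_conj U⟩
  have h' := h.conjTranspose_mul_mul_same U
  have : Uᴴ * (U * diagonal d * Uᵀ) * U = diagonal d := by
    rw [conjTranspose_eq_transpose_of_trivial]
    calc Uᵀ * (U * diagonal d * Uᵀ) * U = (Uᵀ * U) * diagonal d * (Uᵀ * U) := by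
          simp only [Matrix.mul_assoc]
      _ = diagonal d := by simp [hU]
  rw [this] at h'
  exact fun i => posSemidef_diagonal_iff.mp h' i

theorem posDef_orthogonal_conj_iff {U : Matrix ι ι ℝ} (hU : Uᵀ * U = 1) {d : ι → ℝ} :
    (U * diagonal d * Uᵀ).PosDef ↔ ∀ i, 0 < d i := by
  have hu : IsUnit U := (isUnit_iff_isUnit_det _).2 (isUnit_det_of_left_inverse hU)
  have := Matrix.IsUnit.posDef_star_right_conjugate_iff (x := diagonal d) hu
  rw [star_eq_conjTranspose, conjTranspose_eq_transpose_of_trivial] at this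
  rw [this, posDef_diagonal_iff]

theorem exp_orthogonal_conj {U : Matrix ι ι ℝ} (hU : Uᵀ * U = 1) (d : ι → ℝ) :
    NormedSpace.exp (U * diagonal d * Uᵀ) = U * diagonal (fun i => Real.exp (d i)) * Uᵀ := by
  have hu : IsUnit U := (isUnit_iff_isUnit_det _).2 (isUnit_det_of_left_inverse hU)
  rw [← inv_eq_left_inv hU, exp_conj _ _ hu, exp_diagonal]
  congr 3
  ext i
  rw [Pi.coe_exp, Real.exp_eq_exp_ℝ]

theorem trace_orthogonal_conj {U : Matrix ι ι ℝ} (hU : Uᵀ * U = 1) (d : ι → ℝ) :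
    (U * diagonal d * Uᵀ).trace = ∑ i, d i := by
  rw [trace_mul_comm, ← Matrix.mul_assoc, hU, Matrix.one_mul, trace_diagonal]

theorem posDef_exp {S : Matrix ι ι ℝ} (hS : S.IsHermitian) : (NormedSpace.exp S).PosDef := by
  obtain ⟨U, d, hU, -, rfl⟩ := exists_orthogonal_diagonalization hS
  rw [exp_orthogonal_conj hU, posDef_orthogonal_conj_iff hU]
  exact fun i => Real.exp_pos _

theorem exists_exp_eq_of_posDef {P : Matrix ι ι ℝ} (hP : P.PosDef) :
    ∃ S : Matrix ι ι ℝ, S.IsHermitian ∧ NormedSpace.exp S = P := by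
  obtain ⟨U, d, hU, -, rfl⟩ := exists_orthogonal_diagonalization hP.1
  rw [posDef_orthogonal_conj_iff hU] at hP
  refine ⟨U * diagonal (fun i => Real.log (d i)) * Uᵀ, isHermitian_orthogonal_conj _ _, ?_⟩
  rw [exp_orthogonal_conj hU]
  simp only [Real.exp_log (hP _)]

theorem exp_add_smul_one (S : Matrix ι ι ℝ) (c : ℝ) :
    NormedSpace.exp (S + c • (1 : Matrix ι ι ℝ)) = Real.exp c • NormedSpace.exp S := by
  rw [exp_add_of_commute _ _ ((Commute.one_right S).smul_right c)]
  have h := exp_orthogonal_conj (U := (1 : Matrix ι ι ℝ)) (by simp) (fun _ => c)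
  simp only [Matrix.one_mul, transpose_one, Matrix.mul_one] at h
  rw [smul_one_eq_diagonal, h, ← smul_one_eq_diagonal, mul_smul_comm, Matrix.mul_one]

end Spectral

section RelativeEntropy

variable {ι : Type*} [Fintype ι]

/-- For fixed `W` this is linear in `(A, B)`; its supremum over `W` is the quadratic form of
`B - A` with respect to the inverse of the operator `W ↦ u W B + (1 - u) A W`. -/
noncomputable def dualEnergy (u : ℝ) (A B W : Matrix ι ι ℝ) : ℝ :=
  2 * ((B * Wᵀ).trace - (A * Wᵀ).trace) - u * (W * B * Wᵀ).trace - (1 - u) * (Wᵀ * A * W).trace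

theorem dualEnergy_sum {κ : Type*} (t : Finset κ) (u : ℝ) (c : κ → ℝ) (A B : κ → Matrix ι ι ℝ)
    (W : Matrix ι ι ℝ) :
    dualEnergy u (∑ k ∈ t, c k • A k) (∑ k ∈ t, c k • B k) W
      = ∑ k ∈ t, c k * dualEnergy u (A k) (B k) W := by
  simp only [dualEnergy, Matrix.sum_mul, trace_sum, Matrix.smul_mul,
    Matrix.mul_smul, trace_smul, smul_eq_mul, Finset.mul_sum, ← Finset.sum_sub_distrib]
  exact Finset.sum_congr rfl fun k _ => by ring

variable [DecidableEq ι]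

theorem trace_mul_orthogonal_conj {U V : Matrix ι ι ℝ} (hV : V * Vᵀ = 1) (a : ι → ℝ)
    (W : Matrix ι ι ℝ) :
    (U * diagonal a * Uᵀ * Wᵀ).trace = ∑ i, ∑ j, (Uᵀ * V) i j * (Uᵀ * W * V) i j * a i := by
  have : (U * diagonal a * Uᵀ * Wᵀ).trace
      = (diagonal a * ((Uᵀ * V) * (Uᵀ * W * V)ᵀ)).trace := by
    rw [Matrix.mul_assoc, Matrix.mul_assoc, trace_mul_comm]
    congr 1
    rw [transpose_mul, transpose_mul, transpose_transpose]
    calc diagonal a * (Uᵀ * Wᵀ) * U = diagonal a * (Uᵀ * 1 * Wᵀ * U) := by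
          simp only [Matrix.mul_assoc, Matrix.one_mul]
      _ = _ := by rw [← hV]; simp only [Matrix.mul_assoc]
  rw [this, trace]
  refine Finset.sum_congr rfl fun i _ => ?_
  rw [diag_apply, diagonal_mul, mul_apply, Finset.mul_sum]
  exact Finset.sum_congr rfl fun j _ => by rw [transpose_apply]; ring

theorem trace_transpose_mul_orthogonal_conj_mul {U V : Matrix ι ι ℝ} (hV : V * Vᵀ = 1)
    (a : ι → ℝ) (W : Matrix ι ι ℝ) :
    (Wᵀ * (U * diagonal a * Uᵀ) * W).trace = ∑ i, ∑ j, (Uᵀ * W * V) i j ^ 2 * a i := by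
  have : (Wᵀ * (U * diagonal a * Uᵀ) * W).trace
      = (diagonal a * ((Uᵀ * W * V) * (Uᵀ * W * V)ᵀ)).trace := by
    have h1 : Wᵀ * (U * diagonal a * Uᵀ) * W = (Wᵀ * U) * (diagonal a * (Uᵀ * W)) := by
      simp only [Matrix.mul_assoc]
    rw [h1, trace_mul_comm]
    congr 1
    rw [transpose_mul, transpose_mul, transpose_transpose]
    calc diagonal a * (Uᵀ * W) * (Wᵀ * U) = diagonal a * (Uᵀ * W * 1 * (Wᵀ * U)) := by
          simp only [Matrix.mul_assoc, Matrix.one_mul]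
      _ = _ := by rw [← hV]; simp only [Matrix.mul_assoc]
  rw [this, trace]
  refine Finset.sum_congr rfl fun i _ => ?_
  rw [diag_apply, diagonal_mul, mul_apply, Finset.mul_sum]
  exact Finset.sum_congr rfl fun j _ => by rw [transpose_apply]; ring

/-- The relative entropy of the positive definite matrices `exp S` and `exp Z`. -/
noncomputable def expRelEntropy (S Z : Matrix ι ι ℝ) : ℝ :=
  (NormedSpace.exp S * (S - Z)).trace - (NormedSpace.exp S).trace + (NormedSpace.exp Z).trace

theorem dualEnergy_orthogonal_conj {U V : Matrix ι ι ℝ} (hU : U * Uᵀ = 1) (hV : V * Vᵀ = 1)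
    (u : ℝ) (a b : ι → ℝ) (W : Matrix ι ι ℝ) :
    dualEnergy u (U * diagonal a * Uᵀ) (V * diagonal b * Vᵀ) W
      = ∑ i, ∑ j, (2 * ((Uᵀ * V) i j * (b j - a i)) * (Uᵀ * W * V) i j
          - (u * b j + (1 - u) * a i) * (Uᵀ * W * V) i j ^ 2) := by
  have hQ : ∀ i j, (Vᵀ * U) j i = (Uᵀ * V) i j := fun i j => by
    rw [← transpose_apply (Vᵀ * U), transpose_mul, transpose_transpose]
  have hM : ∀ i j, (Vᵀ * Wᵀ * U) j i = (Uᵀ * W * V) i j := fun i j => by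
    rw [← transpose_apply (Vᵀ * Wᵀ * U)]
    simp only [transpose_mul, transpose_transpose, Matrix.mul_assoc]
  have h1 : (V * diagonal b * Vᵀ * Wᵀ).trace
      = ∑ i, ∑ j, (Uᵀ * V) i j * (Uᵀ * W * V) i j * b j := by
    have h : (V * diagonal b * Vᵀ * Wᵀ).trace = (V * diagonal b * Vᵀ * Wᵀᵀ).trace := by
      rw [transpose_transpose, ← trace_transpose, trace_mul_comm]
      simp [Matrix.mul_assoc, trace_mul_comm W]
    rw [h, trace_mul_orthogonal_conj hU, Finset.sum_comm]
    simp only [hQ, hM]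
  have h2 : (W * (V * diagonal b * Vᵀ) * Wᵀ).trace = ∑ i, ∑ j, (Uᵀ * W * V) i j ^ 2 * b j := by
    have := trace_transpose_mul_orthogonal_conj_mul (U := V) hU b Wᵀ
    rw [transpose_transpose] at this
    rw [this, Finset.sum_comm]
    simp only [hM]
  rw [dualEnergy, h1, h2, trace_mul_orthogonal_conj hV, trace_transpose_mul_orthogonal_conj_mul hV]
  simp only [Finset.mul_sum, ← Finset.sum_sub_distrib]
  exact Finset.sum_congr rfl fun i _ => Finset.sum_congr rfl fun j _ => by ring

theorem isGreatest_dualEnergy {U V : Matrix ι ι ℝ} (hU : U * Uᵀ = 1) (hU' : Uᵀ * U = 1)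
    (hV : V * Vᵀ = 1) (hV' : Vᵀ * V = 1) {u : ℝ} {a b : ι → ℝ}
    (hab : ∀ i j, 0 < u * b j + (1 - u) * a i) :
    IsGreatest (Set.range (dualEnergy u (U * diagonal a * Uᵀ) (V * diagonal b * Vᵀ)))
      (∑ i, ∑ j, (Uᵀ * V) i j ^ 2 * ((b j - a i) ^ 2 / (u * b j + (1 - u) * a i))) := by
  constructor
  · let M : Matrix ι ι ℝ := fun i j => (Uᵀ * V) i j * (b j - a i) / (u * b j + (1 - u) * a i)
    have hM : Uᵀ * (U * M * Vᵀ) * V = M := by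
      calc Uᵀ * (U * M * Vᵀ) * V = (Uᵀ * U) * M * (Vᵀ * V) := by simp only [Matrix.mul_assoc]
        _ = M := by simp [hU', hV']
    refine ⟨U * M * Vᵀ, ?_⟩
    rw [dualEnergy_orthogonal_conj hU hV, hM]
    refine Finset.sum_congr rfl fun i _ => Finset.sum_congr rfl fun j _ => ?_
    have := (hab i j).ne'
    simp only [M]
    field_simp
    ring
  · rintro _ ⟨W, rfl⟩
    rw [dualEnergy_orthogonal_conj hU hV]
    refine Finset.sum_le_sum fun i _ => Finset.sum_le_sum fun j _ => ?_
    have h := hab i j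
    generalize u * b j + (1 - u) * a i = D at h
    generalize (Uᵀ * W * V) i j = x
    rw [← sub_nonneg]
    have : (Uᵀ * V) i j ^ 2 * ((b j - a i) ^ 2 / D)
        - (2 * ((Uᵀ * V) i j * (b j - a i)) * x - D * x ^ 2)
        = ((Uᵀ * V) i j * (b j - a i) - D * x) ^ 2 / D := by
      field_simp
      ring
    rw [this]
    positivity

theorem convexCombination_pos {a b u : ℝ} (ha : 0 < a) (hb : 0 < b) (hu : u ∈ Set.Icc (0 : ℝ) 1) :
    0 < u * b + (1 - u) * a := by
  rcases hu.1.eq_or_lt with rfl | h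
  · simpa using ha
  · nlinarith [mul_pos h hb, mul_nonneg (sub_nonneg.2 hu.2) ha.le]

theorem integral_scalar_relEntropy {a b : ℝ} (ha : 0 < a) (hb : 0 < b) :
    ∫ u in (0 : ℝ)..1, u * ((b - a) ^ 2 / (u * b + (1 - u) * a))
      = a * (Real.log a - Real.log b) - a + b := by
  have hpos : ∀ u ∈ Set.uIcc (0 : ℝ) 1, u * b + (1 - u) * a ≠ 0 := fun u hu =>
    (convexCombination_pos ha hb (by simpa using hu)).ne'
  have hderiv : ∀ u ∈ Set.uIcc (0 : ℝ) 1,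
      HasDerivAt (fun u : ℝ => (b - a) * u - a * Real.log (u * b + (1 - u) * a))
        (u * ((b - a) ^ 2 / (u * b + (1 - u) * a))) u := fun u hu => by
    have h1 : HasDerivAt (fun u : ℝ => u * b + (1 - u) * a) (b - a) u := by
      exact (((hasDerivAt_id u).mul_const b).add
        (((hasDerivAt_id u).const_sub 1).mul_const a)).congr_deriv (by ring)
    refine (((hasDerivAt_id u).const_mul (b - a)).sub
      ((h1.log (hpos u hu)).const_mul a)).congr_deriv ?_
    have hD := hpos u hu
    obtain ⟨D, hDdef⟩ : ∃ D, D = u * b + (1 - u) * a := ⟨_, rfl⟩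
    rw [← hDdef] at hD ⊢
    field_simp
    rw [hDdef]
    ring
  rw [intervalIntegral.integral_eq_sub_of_hasDerivAt hderiv]
  · simp
    ring
  · refine ContinuousOn.intervalIntegrable ?_
    exact continuousOn_id.mul (continuousOn_const.div (by fun_prop) hpos)

theorem expRelEntropy_orthogonal_conj {U V : Matrix ι ι ℝ} (hU : U * Uᵀ = 1) (hU' : Uᵀ * U = 1)
    (hV : V * Vᵀ = 1) (hV' : Vᵀ * V = 1) (a b : ι → ℝ) :
    expRelEntropy (U * diagonal a * Uᵀ) (V * diagonal b * Vᵀ)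
      = ∑ i, ∑ j, (Uᵀ * V) i j ^ 2 *
          (Real.exp (a i) * (a i - b j) - Real.exp (a i) + Real.exp (b j)) := by
  have hrow : ∀ i, ∑ j, (Uᵀ * V) i j ^ 2 = 1 := fun i => by
    have : ((Uᵀ * V) * (Uᵀ * V)ᵀ) i i = 1 := by
      rw [transpose_mul, transpose_transpose, Matrix.mul_assoc, ← Matrix.mul_assoc V, hV,
        Matrix.one_mul, hU', one_apply_eq]
    rw [← this, mul_apply]
    exact Finset.sum_congr rfl fun j _ => by rw [transpose_apply, sq]
  have hcol : ∀ j, ∑ i, (Uᵀ * V) i j ^ 2 = 1 := fun j => by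
    have : ((Uᵀ * V)ᵀ * (Uᵀ * V)) j j = 1 := by
      rw [transpose_mul, transpose_transpose, Matrix.mul_assoc, ← Matrix.mul_assoc U, hU,
        Matrix.one_mul, hV', one_apply_eq]
    rw [← this, mul_apply]
    exact Finset.sum_congr rfl fun j _ => by rw [transpose_apply, sq]
  have h1 : (U * diagonal (fun i => Real.exp (a i)) * Uᵀ * (V * diagonal b * Vᵀ)).trace
      = ∑ i, ∑ j, (Uᵀ * V) i j ^ 2 * (Real.exp (a i) * b j) := by
    have h : V * diagonal b * Vᵀ = (V * diagonal b * Vᵀ)ᵀ := by simp [Matrix.mul_assoc]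
    have h' : Uᵀ * (V * diagonal b * Vᵀ) * V = (Uᵀ * V) * diagonal b := by
      simp only [Matrix.mul_assoc, hV', Matrix.mul_one]
    rw [h, trace_mul_orthogonal_conj hV, h']
    refine Finset.sum_congr rfl fun i _ => Finset.sum_congr rfl fun j _ => ?_
    rw [mul_diagonal]
    ring
  have h2 : (U * diagonal (fun i => Real.exp (a i)) * Uᵀ * (U * diagonal a * Uᵀ)).trace
      = ∑ i, Real.exp (a i) * a i := by
    have : U * diagonal (fun i => Real.exp (a i)) * Uᵀ * (U * diagonal a * Uᵀ)
        = U * diagonal (fun i => Real.exp (a i) * a i) * Uᵀ := by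
      calc _ = U * diagonal (fun i => Real.exp (a i)) * (Uᵀ * U) * diagonal a * Uᵀ := by
            simp only [Matrix.mul_assoc]
        _ = _ := by rw [hU', Matrix.mul_one, Matrix.mul_assoc U, diagonal_mul_diagonal]
    rw [this, trace_orthogonal_conj hU']
  have h3 : ∀ f : ι → ℝ, ∑ i, ∑ j, (Uᵀ * V) i j ^ 2 * f i = ∑ i, f i := fun f => by
    simp only [← Finset.sum_mul, hrow, one_mul]
  have h4 : ∀ f : ι → ℝ, ∑ i, ∑ j, (Uᵀ * V) i j ^ 2 * f j = ∑ j, f j := fun f => by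
    rw [Finset.sum_comm]
    simp only [← Finset.sum_mul, hcol, one_mul]
  rw [expRelEntropy, exp_orthogonal_conj hU', exp_orthogonal_conj hV', Matrix.mul_sub, trace_sub,
    h1, h2, trace_orthogonal_conj hU', trace_orthogonal_conj hV']
  simp only [mul_add, mul_sub, Finset.sum_add_distrib, Finset.sum_sub_distrib, h3, h4]

theorem expRelEntropy_nonneg {S Z : Matrix ι ι ℝ} (hS : S.IsHermitian) (hZ : Z.IsHermitian) :
    0 ≤ expRelEntropy S Z := by
  obtain ⟨U, a, hU', hU, rfl⟩ := exists_orthogonal_diagonalization hS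
  obtain ⟨V, b, hV', hV, rfl⟩ := exists_orthogonal_diagonalization hZ
  rw [expRelEntropy_orthogonal_conj hU hU' hV hV']
  refine Finset.sum_nonneg fun i _ => Finset.sum_nonneg fun j _ => mul_nonneg (sq_nonneg _) ?_
  have h := Real.add_one_le_exp (b j - a i)
  have h' : Real.exp (b j) = Real.exp (a i) * Real.exp (b j - a i) := by
    rw [← Real.exp_add]; ring_nf
  rw [h']
  nlinarith [Real.exp_pos (a i)]

theorem intervalIntegrable_fun_sum {κ : Type*} {t : Finset κ} {f : κ → ℝ → ℝ} {a b : ℝ}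
    (h : ∀ k ∈ t, IntervalIntegrable (f k) MeasureTheory.volume a b) :
    IntervalIntegrable (fun u => ∑ k ∈ t, f k u) MeasureTheory.volume a b := by
  simpa only [Finset.sum_fn] using IntervalIntegrable.sum t h

theorem exists_expRelEntropy_eq_integral {S Z : Matrix ι ι ℝ} (hS : S.IsHermitian)
    (hZ : Z.IsHermitian) :
    ∃ J : ℝ → ℝ, IntervalIntegrable (fun u => u * J u) MeasureTheory.volume 0 1 ∧
      expRelEntropy S Z = ∫ u in (0 : ℝ)..1, u * J u ∧
      ∀ u ∈ Set.Icc (0 : ℝ) 1,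
        IsGreatest (Set.range (dualEnergy u (NormedSpace.exp S) (NormedSpace.exp Z))) (J u) := by
  obtain ⟨U, a, hU', hU, rfl⟩ := exists_orthogonal_diagonalization hS
  obtain ⟨V, b, hV', hV, rfl⟩ := exists_orthogonal_diagonalization hZ
  have hpos : ∀ u ∈ Set.Icc (0 : ℝ) 1, ∀ i j,
      0 < u * Real.exp (b j) + (1 - u) * Real.exp (a i) := fun u hu i j =>
    convexCombination_pos (Real.exp_pos _) (Real.exp_pos _) hu
  have hint : ∀ i j, IntervalIntegrable (fun u : ℝ => u * ((Real.exp (b j) - Real.exp (a i)) ^ 2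
      / (u * Real.exp (b j) + (1 - u) * Real.exp (a i)))) MeasureTheory.volume 0 1 := fun i j => by
    refine ContinuousOn.intervalIntegrable ?_
    exact continuousOn_id.mul (continuousOn_const.div (by fun_prop)
      fun u hu => (hpos u (by simpa using hu) i j).ne')
  have heq : ∀ u : ℝ, u * ∑ i, ∑ j, (Uᵀ * V) i j ^ 2 * ((Real.exp (b j) - Real.exp (a i)) ^ 2
      / (u * Real.exp (b j) + (1 - u) * Real.exp (a i)))
      = ∑ i, ∑ j, (Uᵀ * V) i j ^ 2 * (u * ((Real.exp (b j) - Real.exp (a i)) ^ 2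
      / (u * Real.exp (b j) + (1 - u) * Real.exp (a i)))) := fun u => by
    simp only [Finset.mul_sum, mul_left_comm u]
  refine ⟨fun u => ∑ i, ∑ j, (Uᵀ * V) i j ^ 2 * ((Real.exp (b j) - Real.exp (a i)) ^ 2
      / (u * Real.exp (b j) + (1 - u) * Real.exp (a i))), ?_, ?_, fun u hu => ?_⟩
  · simp only [heq]
    exact intervalIntegrable_fun_sum fun i _ => intervalIntegrable_fun_sum fun j _ =>
      (hint i j).const_mul _
  · simp only [heq]
    rw [intervalIntegral.integral_finsetSum fun i _ => intervalIntegrable_fun_sum fun j _ =>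
      (hint i j).const_mul _, expRelEntropy_orthogonal_conj hU hU' hV hV']
    refine Finset.sum_congr rfl fun i _ => ?_
    rw [intervalIntegral.integral_finsetSum fun j _ => (hint i j).const_mul _]
    refine Finset.sum_congr rfl fun j _ => ?_
    rw [intervalIntegral.integral_const_mul,
      integral_scalar_relEntropy (Real.exp_pos _) (Real.exp_pos _), Real.log_exp, Real.log_exp]
  · rw [exp_orthogonal_conj hU', exp_orthogonal_conj hV']
    exact isGreatest_dualEnergy hU hU' hV hV' (hpos u hu)

/-- Joint convexity (and homogeneity) of the relative entropy. -/
theorem expRelEntropy_le_sum {κ : Type*} (t : Finset κ) {c : κ → ℝ} (hc : ∀ k ∈ t, 0 ≤ c k)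
    {S Z : κ → Matrix ι ι ℝ} (hS : ∀ k, (S k).IsHermitian) (hZ : ∀ k, (Z k).IsHermitian)
    {S₀ Z₀ : Matrix ι ι ℝ} (hS₀ : S₀.IsHermitian) (hZ₀ : Z₀.IsHermitian)
    (hSsum : NormedSpace.exp S₀ = ∑ k ∈ t, c k • NormedSpace.exp (S k))
    (hZsum : NormedSpace.exp Z₀ = ∑ k ∈ t, c k • NormedSpace.exp (Z k)) :
    expRelEntropy S₀ Z₀ ≤ ∑ k ∈ t, c k * expRelEntropy (S k) (Z k) := by
  choose J hJint hJeq hJ using fun k => exists_expRelEntropy_eq_integral (hS k) (hZ k)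
  obtain ⟨J₀, hJ₀int, hJ₀eq, hJ₀⟩ := exists_expRelEntropy_eq_integral hS₀ hZ₀
  have hsum : ∑ k ∈ t, c k * expRelEntropy (S k) (Z k)
      = ∫ u in (0 : ℝ)..1, ∑ k ∈ t, c k * (u * J k u) := by
    rw [intervalIntegral.integral_finsetSum fun k _ => (hJint k).const_mul _]
    exact Finset.sum_congr rfl fun k _ => by rw [hJeq, intervalIntegral.integral_const_mul]
  rw [hsum, hJ₀eq]
  refine intervalIntegral.integral_mono_on zero_le_one hJ₀int
    (intervalIntegrable_fun_sum fun k _ => (hJint k).const_mul _) fun u hu => ?_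
  obtain ⟨W, hW⟩ := (hJ₀ u hu).1
  rw [hSsum, hZsum, dualEnergy_sum] at hW
  simp only [mul_left_comm _ u, ← Finset.mul_sum, ← hW]
  refine mul_le_mul_of_nonneg_left (Finset.sum_le_sum fun k hk => ?_) hu.1
  exact mul_le_mul_of_nonneg_left ((hJ k u hu).2 ⟨W, rfl⟩) (hc k hk)

/-- **Lieb's theorem**: `A ↦ trace (exp (H + log A))` is concave and homogeneous. -/
theorem sum_trace_exp_add_le {κ : Type*} (t : Finset κ) {c : κ → ℝ} (hc : ∀ k ∈ t, 0 ≤ c k)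
    (hpos : ∃ k ∈ t, 0 < c k) {H : Matrix ι ι ℝ} (hH : H.IsHermitian)
    {Z : κ → Matrix ι ι ℝ} (hZ : ∀ k, (Z k).IsHermitian) {Z₀ : Matrix ι ι ℝ}
    (hZ₀ : Z₀.IsHermitian)
    (hZsum : NormedSpace.exp Z₀ = ∑ k ∈ t, c k • NormedSpace.exp (Z k)) :
    ∑ k ∈ t, c k * (NormedSpace.exp (H + Z k)).trace ≤ (NormedSpace.exp (H + Z₀)).trace := by
  classical
  have hPD : (∑ k ∈ t, c k • NormedSpace.exp (H + Z k)).PosDef := by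
    obtain ⟨k₀, hk₀, hck₀⟩ := hpos
    rw [← Finset.add_sum_erase t _ hk₀]
    refine ((posDef_exp (hH.add (hZ k₀))).smul hck₀).add_posSemidef
      (posSemidef_sum _ fun k hk => ?_)
    exact (posDef_exp (hH.add (hZ k))).posSemidef.smul (hc k (Finset.mem_of_mem_erase hk))
  obtain ⟨S₀, hS₀, hS₀sum⟩ := exists_exp_eq_of_posDef hPD
  have hconv := expRelEntropy_le_sum t hc (fun k => hH.add (hZ k)) hZ hS₀ hZ₀ hS₀sum hZsum
  have hklein := expRelEntropy_nonneg hS₀ (hH.add hZ₀)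
  have hterm : ∑ k ∈ t, c k * expRelEntropy (H + Z k) (Z k)
      = (NormedSpace.exp S₀ * H).trace - ∑ k ∈ t, c k * (NormedSpace.exp (H + Z k)).trace
        + (NormedSpace.exp Z₀).trace := by
    simp only [expRelEntropy, add_sub_cancel_right, hS₀sum, hZsum, Matrix.sum_mul, trace_sum,
      smul_mul, trace_smul, smul_eq_mul, mul_add, mul_sub, Finset.sum_add_distrib,
      Finset.sum_sub_distrib]
  rw [hterm] at hconv
  simp only [expRelEntropy, Matrix.mul_sub, Matrix.mul_add, trace_sub, trace_add] at hconv hklein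
  linarith

end RelativeEntropy

section MatrixBernstein

variable {ι : Type*} [Fintype ι] [DecidableEq ι]

theorem sum_trace_exp_add_le_of_posSemidef {κ : Type*} [Fintype κ] {p : κ → ℝ}
    (hp : ∀ k, 0 ≤ p k) {Z : κ → Matrix ι ι ℝ} (hZ : ∀ k, (Z k).IsHermitian)
    {G : Matrix ι ι ℝ} (hG : G.IsHermitian)
    (hmgf : (NormedSpace.exp G - ∑ k, p k • NormedSpace.exp (Z k)).PosSemidef)
    {H : Matrix ι ι ℝ} (hH : H.IsHermitian) :
    ∑ k, p k * (NormedSpace.exp (H + Z k)).trace ≤ (NormedSpace.exp (H + G)).trace := by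
  have hshift : ∀ c : ℝ, 0 < c → ∑ k, p k * (NormedSpace.exp (H + Z k)).trace
      ≤ Real.exp c * (NormedSpace.exp (H + G)).trace := fun c hc => by
    have hone : (c • (1 : Matrix ι ι ℝ)).IsHermitian := by simp [IsHermitian]
    have hPD : (NormedSpace.exp (G + c • (1 : Matrix ι ι ℝ))
        - ∑ k, p k • NormedSpace.exp (Z k)).PosDef := by
      have h := ((posDef_exp hG).smul (sub_pos.2 (Real.one_lt_exp_iff.2 hc))).add_posSemidef hmgf
      convert h using 1
      rw [exp_add_smul_one]
      module
    obtain ⟨Q, hQ, hQexp⟩ := exists_exp_eq_of_posDef hPD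
    have hlieb := sum_trace_exp_add_le (Finset.univ : Finset (Option κ))
      (c := fun o => o.elim 1 p) (Z := fun o => o.elim Q Z) (Z₀ := G + c • (1 : Matrix ι ι ℝ))
      (by rintro (_ | k) _ <;> simp [hp]) ⟨none, Finset.mem_univ _, by simp⟩ hH
      (by rintro (_ | k); exacts [hQ, hZ k]) (hG.add hone)
      (by simp [Fintype.sum_option, hQexp])
    rw [Fintype.sum_option] at hlieb
    simp only [Option.elim_none, Option.elim_some, one_mul] at hlieb
    rw [← add_assoc, exp_add_smul_one, trace_smul, smul_eq_mul] at hlieb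
    have := (posDef_exp (hH.add hQ)).posSemidef.trace_nonneg
    linarith
  have hlim : Filter.Tendsto (fun c : ℝ => Real.exp c * (NormedSpace.exp (H + G)).trace)
      (nhdsWithin 0 (Set.Ioi 0)) (nhds ((NormedSpace.exp (H + G)).trace)) := by
    have : Continuous fun c : ℝ => Real.exp c * (NormedSpace.exp (H + G)).trace := by fun_prop
    simpa using (this.tendsto 0).mono_left nhdsWithin_le_nhds
  exact ge_of_tendsto hlim (Filter.eventually_of_mem self_mem_nhdsWithin hshift)

/-- Subadditivity of matrix cumulant generating functions for independent sampling. -/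
theorem sum_prod_mul_trace_exp_le {n : ℕ} {p : Fin n → ℝ} (hp : ∀ k, 0 ≤ p k)
    {Z : Fin n → Matrix ι ι ℝ} (hZ : ∀ k, (Z k).IsHermitian)
    {G : Matrix ι ι ℝ} (hG : G.IsHermitian)
    (hmgf : (NormedSpace.exp G - ∑ k, p k • NormedSpace.exp (Z k)).PosSemidef) (s : ℕ) :
    ∀ {H : Matrix ι ι ℝ}, H.IsHermitian →
      ∑ ω : Fin s → Fin n, (∏ i, p (ω i)) * (NormedSpace.exp (H + ∑ i, Z (ω i))).trace
        ≤ (NormedSpace.exp (H + (s : ℝ) • G)).trace := by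
  induction s with
  | zero => intro H _; simp
  | succ s ih =>
    intro H hH
    have hsG : ((s : ℝ) • G).IsHermitian := by
      rw [IsHermitian, conjTranspose_smul, hG.eq, star_trivial]
    rw [← (Fin.consEquiv fun _ => Fin n).sum_comp, Fintype.sum_prod_type]
    calc _ = ∑ k, p k * ∑ ω : Fin s → Fin n,
          (∏ i, p (ω i)) * (NormedSpace.exp ((H + Z k) + ∑ i, Z (ω i))).trace := by
          refine Finset.sum_congr rfl fun k _ => ?_
          rw [Finset.mul_sum]
          refine Finset.sum_congr rfl fun ω _ => ?_
          simp [Fin.consEquiv, Fin.prod_univ_succ, Fin.sum_univ_succ, add_assoc, mul_assoc]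
      _ ≤ ∑ k, p k * (NormedSpace.exp ((H + (s : ℝ) • G) + Z k)).trace := by
          refine Finset.sum_le_sum fun k _ => mul_le_mul_of_nonneg_left ?_ (hp k)
          rw [add_right_comm]
          exact ih (hH.add (hZ k))
      _ ≤ (NormedSpace.exp ((H + (s : ℝ) • G) + G)).trace :=
          sum_trace_exp_add_le_of_posSemidef hp hZ hG hmgf (hH.add hsG)
      _ = _ := by
          congr 2
          push_cast
          module

theorem exp_mul_one_sub_div_three_le (x : ℝ) :
    Real.exp x * (1 - x / 3) ≤ 1 + 2 * x / 3 + x ^ 2 / 6 := by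
  let F : ℝ → ℝ := fun y => 1 + 2 * y / 3 + y ^ 2 / 6 - Real.exp y * (1 - y / 3)
  let F' : ℝ → ℝ := fun y => 2 / 3 + y / 3 - Real.exp y * (2 / 3 - y / 3)
  have hF : ∀ y, HasDerivAt F (F' y) y := fun y => by
    have h1 := ((((hasDerivAt_id y).const_mul 2).div_const 3).const_add 1).add
      ((hasDerivAt_pow 2 y).div_const 6)
    have h2 := (Real.hasDerivAt_exp y).mul (((hasDerivAt_id y).div_const 3).const_sub 1)
    refine (h1.sub h2).congr_deriv ?_
    simp only [F', id]
    push_cast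
    ring
  have hF' : ∀ y, HasDerivAt F' ((1 - Real.exp y * (1 - y)) / 3) y := fun y => by
    have h1 := ((hasDerivAt_id y).div_const 3).const_add (2 / 3)
    have h2 := (Real.hasDerivAt_exp y).mul (((hasDerivAt_id y).div_const 3).const_sub (2 / 3))
    refine (h1.sub h2).congr_deriv ?_
    simp only [id]
    ring
  have hmono : Monotone F' := by
    refine monotone_of_hasDerivAt_nonneg hF' fun y => ?_
    have h1 := Real.add_one_le_exp (-y)
    have h2 : Real.exp y * Real.exp (-y) = 1 := by rw [← Real.exp_add]; simp
    have h3 := mul_le_mul_of_nonneg_left h1 (Real.exp_pos y).le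
    simp only [Pi.zero_apply]
    linarith
  have hF'0 : F' 0 = 0 := by simp [F']
  have hF0 : F 0 = 0 := by simp [F]
  have hcont : Continuous F := continuous_iff_continuousAt.2 fun y => (hF y).continuousAt
  have hnonneg : 0 ≤ F x := by
    rcases le_total 0 x with hx | hx
    · have : MonotoneOn F (Set.Ici 0) := by
        refine monotoneOn_of_hasDerivWithinAt_nonneg (convex_Ici 0) hcont.continuousOn
          (fun y _ => (hF y).hasDerivWithinAt) fun y hy => ?_
        rw [interior_Ici] at hy
        exact hF'0 ▸ hmono (le_of_lt hy)
      exact hF0 ▸ this Set.self_mem_Ici hx hx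
    · have : AntitoneOn F (Set.Iic 0) := by
        refine antitoneOn_of_hasDerivWithinAt_nonpos (convex_Iic 0) hcont.continuousOn
          (fun y _ => (hF y).hasDerivWithinAt) fun y hy => ?_
        rw [interior_Iic] at hy
        exact hF'0 ▸ hmono (le_of_lt hy)
      exact hF0 ▸ this hx Set.self_mem_Iic hx
  simp only [F] at hnonneg
  linarith

/-- The scalar bound behind Bernstein's inequality. -/
theorem exp_le_one_add_add_sq {x c : ℝ} (hxc : x ≤ c) (hc : c < 3) :
    Real.exp x ≤ 1 + x + 1 / (2 * (1 - c / 3)) * x ^ 2 := by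
  have h := exp_mul_one_sub_div_three_le x
  have hx : 0 < 1 - x / 3 := by linarith
  have h1 : Real.exp x - 1 - x ≤ 1 / (2 * (1 - x / 3)) * x ^ 2 := by
    rw [div_mul_eq_mul_div, le_div_iff₀ (by positivity)]
    linarith
  have h2 : 1 / (2 * (1 - x / 3)) * x ^ 2 ≤ 1 / (2 * (1 - c / 3)) * x ^ 2 := by
    refine mul_le_mul_of_nonneg_right ?_ (sq_nonneg x)
    exact one_div_le_one_div_of_le (by linarith) (by linarith)
  linarith

theorem orthogonal_conj_smul_one_sub {U : Matrix ι ι ℝ} (hU : U * Uᵀ = 1) (c : ℝ) (d : ι → ℝ) :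
    c • (1 : Matrix ι ι ℝ) - U * diagonal d * Uᵀ = U * diagonal (fun i => c - d i) * Uᵀ := by
  rw [← diagonal_sub, ← smul_one_eq_diagonal, Matrix.mul_sub, Matrix.sub_mul, Matrix.mul_smul,
    Matrix.mul_one, Matrix.smul_mul, hU]

theorem smul_orthogonal_conj (U : Matrix ι ι ℝ) (c : ℝ) (d : ι → ℝ) :
    c • (U * diagonal d * Uᵀ) = U * diagonal (fun i => c * d i) * Uᵀ := by
  rw [← Matrix.smul_mul, ← Matrix.mul_smul, ← diagonal_smul]
  rfl

theorem posSemidef_bernstein_sub_exp {X : Matrix ι ι ℝ} (hX : X.IsHermitian) {c : ℝ}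
    (hXc : (c • (1 : Matrix ι ι ℝ) - X).PosSemidef) (hc : c < 3) :
    (1 + X + (1 / (2 * (1 - c / 3))) • (X * X) - NormedSpace.exp X).PosSemidef := by
  obtain ⟨U, d, hU', hU, rfl⟩ := exists_orthogonal_diagonalization hX
  rw [orthogonal_conj_smul_one_sub hU, posSemidef_orthogonal_conj_iff hU'] at hXc
  rw [exp_orthogonal_conj hU']
  have hsq : U * diagonal d * Uᵀ * (U * diagonal d * Uᵀ)
      = U * diagonal (fun i => d i * d i) * Uᵀ := by
    calc _ = U * diagonal d * (Uᵀ * U) * diagonal d * Uᵀ := by simp only [Matrix.mul_assoc]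
      _ = _ := by rw [hU', Matrix.mul_one, Matrix.mul_assoc U, diagonal_mul_diagonal]
  have heq : 1 + U * diagonal d * Uᵀ
      + (1 / (2 * (1 - c / 3))) • (U * diagonal d * Uᵀ * (U * diagonal d * Uᵀ))
      - U * diagonal (fun i => Real.exp (d i)) * Uᵀ
      = U * diagonal (fun i => 1 + d i + 1 / (2 * (1 - c / 3)) * (d i * d i)
        - Real.exp (d i)) * Uᵀ := by
    rw [hsq, smul_orthogonal_conj, ← diagonal_sub, ← diagonal_add, ← diagonal_add, diagonal_one]
    simp only [Matrix.mul_sub, Matrix.mul_add, Matrix.sub_mul, Matrix.add_mul, Matrix.mul_one, hU]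
  rw [heq, posSemidef_orthogonal_conj_iff hU']
  intro i
  have := exp_le_one_add_add_sq (sub_nonneg.1 (hXc i)) hc
  rw [sq] at this
  linarith

theorem posSemidef_exp_sub_one_sub {G : Matrix ι ι ℝ} (hG : G.IsHermitian) :
    (NormedSpace.exp G - 1 - G).PosSemidef := by
  obtain ⟨U, d, hU', hU, rfl⟩ := exists_orthogonal_diagonalization hG
  rw [exp_orthogonal_conj hU']
  have heq : U * diagonal (fun i => Real.exp (d i)) * Uᵀ - 1 - U * diagonal d * Uᵀ
      = U * diagonal (fun i => Real.exp (d i) - 1 - d i) * Uᵀ := by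
    rw [← diagonal_sub, ← diagonal_sub, diagonal_one]
    simp only [Matrix.mul_sub, Matrix.sub_mul, Matrix.mul_one, hU]
  rw [heq, posSemidef_orthogonal_conj_iff hU']
  intro i
  linarith [Real.add_one_le_exp (d i)]

/-- Bernstein bound for the matrix moment generating function. -/
theorem posSemidef_exp_sub_sum_exp {κ : Type*} [Fintype κ] {p : κ → ℝ} (hp : ∀ k, 0 ≤ p k)
    (hsum : ∑ k, p k = 1) {X : κ → Matrix ι ι ℝ} (hX : ∀ k, (X k).IsHermitian)
    (hmean : ∑ k, p k • X k = 0) {c : ℝ} (hc : c < 3)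
    (hXc : ∀ k, (c • (1 : Matrix ι ι ℝ) - X k).PosSemidef) {V : Matrix ι ι ℝ}
    (hV : V.IsHermitian) (hvar : (V - ∑ k, p k • (X k * X k)).PosSemidef) :
    (NormedSpace.exp ((1 / (2 * (1 - c / 3))) • V)
      - ∑ k, p k • NormedSpace.exp (X k)).PosSemidef := by
  have hγ : (0 : ℝ) ≤ 1 / (2 * (1 - c / 3)) := by
    have : 0 < 1 - c / 3 := by linarith
    positivity
  generalize hγdef : (1 : ℝ) / (2 * (1 - c / 3)) = γ at hγ
  have hG : (γ • V).IsHermitian := by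
    rw [IsHermitian, conjTranspose_smul, hV.eq, star_trivial]
  have hterm : (∑ k, p k • (1 + X k + γ • (X k * X k) - NormedSpace.exp (X k))).PosSemidef :=
    posSemidef_sum _ fun k _ => by
      rw [← hγdef]
      exact (posSemidef_bernstein_sub_exp (hX k) (hXc k) hc).smul (hp k)
  have := ((posSemidef_exp_sub_one_sub hG).add hterm).add (hvar.smul hγ)
  convert this using 1
  simp only [smul_sub, smul_add, Finset.sum_sub_distrib, Finset.sum_add_distrib, hmean,
    ← Finset.sum_smul, hsum, one_smul, smul_comm _ γ, ← Finset.smul_sum]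
  abel

theorem trace_exp_smul_le {B : Matrix ι ι ℝ} (hB : B.PosSemidef)
    (hB1 : ((1 : ℝ) • (1 : Matrix ι ι ℝ) - B).PosSemidef) (l : ℝ) :
    (NormedSpace.exp (l • B)).trace ≤ Fintype.card ι + B.trace * (Real.exp l - 1) := by
  obtain ⟨U, d, hU', hU, rfl⟩ := exists_orthogonal_diagonalization hB.1
  rw [orthogonal_conj_smul_one_sub hU, posSemidef_orthogonal_conj_iff hU'] at hB1
  rw [posSemidef_orthogonal_conj_iff hU'] at hB
  rw [smul_orthogonal_conj, exp_orthogonal_conj hU', trace_orthogonal_conj hU',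
    trace_orthogonal_conj hU',
    Finset.sum_mul, ← Finset.card_univ, Finset.cast_card, ← Finset.sum_add_distrib]
  refine Finset.sum_le_sum fun i _ => ?_
  have := convexOn_exp.2 (Set.mem_univ 0) (Set.mem_univ l) (hB1 i) (hB i) (by ring)
  simp only [smul_eq_mul, mul_zero, zero_add, Real.exp_zero, mul_one] at this
  rw [mul_comm l]
  linarith

end MatrixBernstein

section SpectralNorm

open scoped Matrix.Norms.L2Operator

theorem specNorm_eq_l2_opNorm {m n : ℕ} (A : Matrix (Fin m) (Fin n) ℝ) : specNorm A = ‖A‖ := rfl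

theorem specNorm_orthogonal_conj {m : ℕ} {U : Matrix (Fin m) (Fin m) ℝ} (hU : U * Uᵀ = 1)
    (hU' : Uᵀ * U = 1) (d : Fin m → ℝ) : specNorm (U * diagonal d * Uᵀ) = ‖d‖ := by
  have hmem : U ∈ unitary (Matrix (Fin m) (Fin m) ℝ) := by
    rw [Unitary.mem_iff, star_eq_conjTranspose, conjTranspose_eq_transpose_of_trivial]
    exact ⟨hU', hU⟩
  have hmem' : Uᵀ ∈ unitary (Matrix (Fin m) (Fin m) ℝ) := by
    rw [← conjTranspose_eq_transpose_of_trivial, ← star_eq_conjTranspose]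
    exact Unitary.star_mem hmem
  rw [specNorm_eq_l2_opNorm, CStarRing.norm_mul_mem_unitary _ hmem',
    CStarRing.norm_mem_unitary_mul _ hmem, l2_opNorm_diagonal]

theorem posSemidef_one_sub_mul_transpose {m n : ℕ} {A : Matrix (Fin m) (Fin n) ℝ}
    (hA : specNorm A ≤ 1) : ((1 : ℝ) • (1 : Matrix (Fin m) (Fin m) ℝ) - A * Aᵀ).PosSemidef := by
  have hnorm : specNorm (A * Aᵀ) ≤ 1 := by
    have h := l2_opNorm_conjTranspose_mul_self Aᵀ
    have h' := l2_opNorm_conjTranspose A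
    simp only [conjTranspose_eq_transpose_of_trivial, transpose_transpose] at h h'
    rw [h'] at h
    rw [specNorm_eq_l2_opNorm] at hA ⊢
    rw [h]
    exact mul_le_one₀ hA (norm_nonneg _) hA
  have hherm : (A * Aᵀ).IsHermitian := by simp [IsHermitian]
  obtain ⟨U, d, hU', hU, hd⟩ := exists_orthogonal_diagonalization hherm
  rw [hd] at hnorm ⊢
  rw [specNorm_orthogonal_conj hU hU'] at hnorm
  rw [orthogonal_conj_smul_one_sub hU, posSemidef_orthogonal_conj_iff hU']
  exact fun i => sub_nonneg.2 ((le_abs_self _).trans ((norm_le_pi_norm d i).trans hnorm))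

theorem card_add_cosh_le_trace_exp {m : ℕ} {Y : Matrix (Fin m) (Fin m) ℝ} (hY : Y.IsHermitian)
    (θ : ℝ) {t : ℝ} (ht : 0 ≤ t) :
    (m : ℝ) + (if specNorm Y ≤ t then 0 else Real.cosh (θ * t) - 1)
      ≤ ((NormedSpace.exp (θ • Y)).trace + (NormedSpace.exp ((-θ) • Y)).trace) / 2 := by
  obtain ⟨U, d, hU', hU, rfl⟩ := exists_orthogonal_diagonalization hY
  have hcosh : ((NormedSpace.exp (θ • (U * diagonal d * Uᵀ))).trace
      + (NormedSpace.exp ((-θ) • (U * diagonal d * Uᵀ))).trace) / 2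
      = m + ∑ i, (Real.cosh (θ * d i) - 1) := by
    rw [smul_orthogonal_conj, smul_orthogonal_conj, exp_orthogonal_conj hU',
      exp_orthogonal_conj hU', trace_orthogonal_conj hU', trace_orthogonal_conj hU',
      ← Finset.sum_add_distrib, Finset.sum_div, Finset.sum_sub_distrib]
    simp [Real.cosh_eq]
  rw [hcosh, specNorm_orthogonal_conj hU hU']
  have hnn : ∀ i ∈ Finset.univ, 0 ≤ Real.cosh (θ * d i) - 1 := fun i _ =>
    sub_nonneg.2 (Real.one_le_cosh _)
  gcongr
  split_ifs with h
  · exact Finset.sum_nonneg hnn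
  · rw [pi_norm_le_iff_of_nonneg ht, not_forall] at h
    obtain ⟨i, hi⟩ := h
    refine le_trans ?_ (Finset.single_le_sum hnn (Finset.mem_univ i))
    gcongr
    rw [Real.cosh_le_cosh, abs_mul, abs_mul, abs_of_nonneg ht]
    exact mul_le_mul_of_nonneg_left (not_le.1 hi).le (abs_nonneg θ)

end SpectralNorm

section Sampling

theorem sum_prod_apply_eq_one {n : ℕ} {p : Fin n → ℝ} (hsum : ∑ k, p k = 1) (s : ℕ) :
    ∑ ω : Fin s → Fin n, ∏ i, p (ω i) = 1 := by
  rw [← Fintype.piFinset_univ, Finset.sum_prod_piFinset]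
  simp [hsum]

theorem Matrix.IsHermitian.real_smul {ι : Type*} {M : Matrix ι ι ℝ} (hM : M.IsHermitian) (c : ℝ) :
    (c • M).IsHermitian := by
  rw [IsHermitian, conjTranspose_smul, hM.eq, star_trivial]

/-- Bernstein bound for the trace moment generating function of a sum of `s` independent
samples. -/
theorem sum_prod_mul_trace_exp_smul_le {m n : ℕ} (s : ℕ) {p : Fin n → ℝ} (hp : ∀ k, 0 ≤ p k)
    (hsum : ∑ k, p k = 1) {X : Fin n → Matrix (Fin m) (Fin m) ℝ} (hX : ∀ k, (X k).IsHermitian)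
    (hmean : ∑ k, p k • X k = 0) {c η : ℝ} (hc : c < 3)
    (hupper : ∀ k, (c • (1 : Matrix (Fin m) (Fin m) ℝ) - η • X k).PosSemidef)
    {B : Matrix (Fin m) (Fin m) ℝ} (hB : B.IsHermitian) {v : ℝ}
    (hvar : (v • B - ∑ k, p k • (X k * X k)).PosSemidef) :
    ∑ ω : Fin s → Fin n, (∏ i, p (ω i)) * (NormedSpace.exp (η • ∑ i, X (ω i))).trace
      ≤ (NormedSpace.exp ((s * (1 / (2 * (1 - c / 3)) * (η ^ 2 * v))) • B)).trace := by
  have hvarη : ((η ^ 2 * v) • B - ∑ k, p k • ((η • X k) * (η • X k))).PosSemidef := by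
    have h := hvar.smul (sq_nonneg η)
    have heq : ∀ k, p k • ((η • X k) * (η • X k)) = η ^ 2 • p k • (X k * X k) := fun k => by
      rw [Matrix.smul_mul, Matrix.mul_smul]
      module
    rwa [smul_sub, smul_smul, Finset.smul_sum, ← Finset.sum_congr rfl fun k _ => heq k] at h
  have hmeanη : ∑ k, p k • (η • X k) = 0 := by
    rw [Finset.sum_congr rfl fun k _ => smul_comm (p k) η (X k), ← Finset.smul_sum, hmean,
      smul_zero]
  have hVη : ((η ^ 2 * v) • B).IsHermitian := hB.real_smul _
  have hmgf := posSemidef_exp_sub_sum_exp hp hsum (fun k => (hX k).real_smul η) hmeanη hc hupper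
    hVη hvarη
  have h := sum_prod_mul_trace_exp_le hp (fun k => (hX k).real_smul η) (hVη.real_smul _) hmgf s
    (isHermitian_zero (n := Fin m) (α := ℝ))
  simpa only [zero_add, ← Finset.smul_sum, smul_smul] using h

theorem sum_prod_mul_ite_eq {n s : ℕ} {p : Fin n → ℝ} (hsum : ∑ k, p k = 1)
    (E : (Fin s → Fin n) → Prop) [DecidablePred E] (c : ℝ) :
    ∑ ω, (∏ i, p (ω i)) * (if E ω then 0 else c) = (1 - probOf p E) * c := by
  rw [sub_mul, one_mul, probOf, Finset.sum_mul, eq_sub_iff_add_eq, ← Finset.sum_add_distrib]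
  calc _ = ∑ ω : Fin s → Fin n, (∏ i, p (ω i)) * c :=
        Finset.sum_congr rfl fun ω _ => by split_ifs <;> ring
    _ = c := by rw [← Finset.sum_mul, sum_prod_apply_eq_one hsum, one_mul]

theorem add_one_sub_probOf_mul_le {n s : ℕ} {p : Fin n → ℝ} (hp : ∀ k, 0 ≤ p k)
    (hsum : ∑ k, p k = 1) (E : (Fin s → Fin n) → Prop) [DecidablePred E] {a c : ℝ}
    {f g : (Fin s → Fin n) → ℝ} (hfg : ∀ ω, a + (if E ω then 0 else c) ≤ (f ω + g ω) / 2) :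
    a + (1 - probOf p E) * c
      ≤ (∑ ω, (∏ i, p (ω i)) * f ω + ∑ ω, (∏ i, p (ω i)) * g ω) / 2 := by
  calc a + (1 - probOf p E) * c
      = ∑ ω : Fin s → Fin n, (∏ i, p (ω i)) * (a + (if E ω then 0 else c)) := by
        simp only [mul_add, Finset.sum_add_distrib, ← Finset.sum_mul, sum_prod_apply_eq_one hsum,
          one_mul, sum_prod_mul_ite_eq hsum]
    _ ≤ ∑ ω : Fin s → Fin n, (∏ i, p (ω i)) * ((f ω + g ω) / 2) :=
        Finset.sum_le_sum fun ω _ =>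
          mul_le_mul_of_nonneg_left (hfg ω) (Finset.prod_nonneg fun i _ => hp _)
    _ = _ := by
        rw [← Finset.sum_add_distrib, Finset.sum_div]
        exact Finset.sum_congr rfl fun ω _ => by ring

/-- Intrinsic-dimension Bernstein tail bound for a sum of `s` independent samples. -/
theorem one_sub_probOf_specNorm_sum_mul_le {m n s : ℕ} {p : Fin n → ℝ} (hp : ∀ k, 0 ≤ p k)
    (hsum : ∑ k, p k = 1) {X : Fin n → Matrix (Fin m) (Fin m) ℝ} (hX : ∀ k, (X k).IsHermitian)
    (hmean : ∑ k, p k • X k = 0) {R : ℝ}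
    (hupper : ∀ k, (R • (1 : Matrix (Fin m) (Fin m) ℝ) - X k).PosSemidef)
    (hlower : ∀ k, (R • (1 : Matrix (Fin m) (Fin m) ℝ) + X k).PosSemidef)
    {B : Matrix (Fin m) (Fin m) ℝ} (hB : B.PosSemidef)
    (hB1 : ((1 : ℝ) • (1 : Matrix (Fin m) (Fin m) ℝ) - B).PosSemidef) {v : ℝ}
    (hvar : (v • B - ∑ k, p k • (X k * X k)).PosSemidef)
    {θ t : ℝ} (hθ : 0 ≤ θ) (hθR : θ * R < 3) (ht : 0 ≤ t) :
    (1 - probOf p (fun ω : Fin s → Fin n => specNorm (∑ i, X (ω i)) ≤ t))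
        * (Real.cosh (θ * t) - 1)
      ≤ B.trace * (Real.exp (s * (1 / (2 * (1 - θ * R / 3)) * (θ ^ 2 * v))) - 1) := by
  have h1 := sum_prod_mul_trace_exp_smul_le s hp hsum hX hmean hθR (η := θ)
    (fun k => by simpa only [smul_sub, smul_smul] using (hupper k).smul hθ) hB.1 hvar
  have h2 := sum_prod_mul_trace_exp_smul_le s hp hsum hX hmean hθR (η := -θ)
    (fun k => by
      simpa only [smul_add, smul_smul, neg_smul, sub_neg_eq_add] using (hlower k).smul hθ)
    hB.1 hvar
  rw [neg_sq] at h2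
  have hherm : ∀ ω : Fin s → Fin n, (∑ i, X (ω i)).IsHermitian := fun ω => by
    rw [IsHermitian, conjTranspose_sum]
    exact Finset.sum_congr rfl fun i _ => hX (ω i)
  have hcosh := add_one_sub_probOf_mul_le hp hsum
    (fun ω : Fin s → Fin n => specNorm (∑ i, X (ω i)) ≤ t)
    fun ω => card_add_cosh_le_trace_exp (hherm ω) θ ht
  have h3 := trace_exp_smul_le hB hB1 (s * (1 / (2 * (1 - θ * R / 3)) * (θ ^ 2 * v)))
  rw [Fintype.card_fin] at h3
  linarith only [hcosh, h1, h2, h3]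

theorem mul_transpose_eq_sum_vecMulVec {m n : ℕ} (A : Matrix (Fin m) (Fin n) ℝ) :
    A * Aᵀ = ∑ k, vecMulVec (A.col k) (A.col k) := by
  ext i j
  simp [mul_apply, Matrix.sum_apply, vecMulVec_apply]

theorem samplingMatrix_gram_eq_sum {m n s : ℕ} (A : Matrix (Fin m) (Fin n) ℝ) {p : Fin n → ℝ}
    (hp : ∀ k, 0 ≤ p k) (ω : Fin s → Fin n) :
    A * (samplingMatrix p s ω)ᵀ * samplingMatrix p s ω * Aᵀ
      = ∑ i, ((s : ℝ) * p (ω i))⁻¹ • vecMulVec (A.col (ω i)) (A.col (ω i)) := by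
  have hAW : ∀ l i, (A * (samplingMatrix p s ω)ᵀ) l i
      = A l (ω i) * (1 / Real.sqrt (s * p (ω i))) := fun l i => by
    simp [mul_apply, samplingMatrix]
  have hT : samplingMatrix p s ω * Aᵀ = (A * (samplingMatrix p s ω)ᵀ)ᵀ := by simp
  rw [Matrix.mul_assoc, hT]
  ext l l'
  rw [mul_apply, Matrix.sum_apply]
  refine Finset.sum_congr rfl fun i _ => ?_
  have hsq : (1 / Real.sqrt (s * p (ω i))) * (1 / Real.sqrt (s * p (ω i)))
      = ((s : ℝ) * p (ω i))⁻¹ := by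
    rw [div_mul_div_comm, Real.mul_self_sqrt (mul_nonneg (Nat.cast_nonneg s) (hp _)), one_mul,
      one_div]
  rw [transpose_apply, hAW, hAW, Matrix.smul_apply, vecMulVec_apply, ← hsq, col_apply, col_apply,
    smul_eq_mul]
  ring

theorem posSemidef_smul_one_sub_vecMulVec {m : ℕ} (a : Fin m → ℝ) :
    ((∑ j, a j ^ 2) • (1 : Matrix (Fin m) (Fin m) ℝ) - vecMulVec a a).PosSemidef := by
  refine PosSemidef.of_dotProduct_mulVec_nonneg ?_ fun x => ?_
  · ext i j
    simp [vecMulVec_apply, one_apply, mul_comm, eq_comm]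
  · have h := Finset.sum_mul_sq_le_sq_mul_sq Finset.univ a x
    simp only [sub_mulVec, smul_mulVec, one_mulVec, dotProduct_sub, dotProduct_smul, star_trivial,
      vecMulVec_mulVec, smul_eq_mul]
    simp only [dotProduct, ← sq, MulOpposite.smul_eq_mul_unop,
      MulOpposite.unop_op]
    simp only [mul_comm (x _)]
    nlinarith

theorem vecMulVec_self_mul_self {m : ℕ} (a : Fin m → ℝ) :
    vecMulVec a a * vecMulVec a a = (∑ j, a j ^ 2) • vecMulVec a a := by
  ext i j
  simp only [mul_apply, vecMulVec_apply, Matrix.smul_apply, smul_eq_mul, Finset.sum_mul]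
  exact Finset.sum_congr rfl fun k _ => by ring

end Sampling

section ColumnSampling

variable {m n : ℕ}

theorem posSemidef_vecMulVec_self (a : Fin m → ℝ) : (vecMulVec a a).PosSemidef := by
  simpa using posSemidef_vecMulVec_self_star a

theorem posSemidef_mul_transpose (A : Matrix (Fin m) (Fin n) ℝ) : (A * Aᵀ).PosSemidef := by
  simpa using posSemidef_self_mul_conjTranspose A

theorem frobNorm_sq (A : Matrix (Fin m) (Fin n) ℝ) :
    frobNorm A ^ 2 = ∑ k, ∑ j, A j k ^ 2 := by
  rw [frobNorm, Real.sq_sqrt (by positivity), Finset.sum_comm]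

theorem trace_mul_transpose (A : Matrix (Fin m) (Fin n) ℝ) :
    (A * Aᵀ).trace = frobNorm A ^ 2 := by
  rw [frobNorm_sq, Finset.sum_comm]
  simp [trace, mul_apply, sq]

theorem posSemidef_frobNorm_sq_smul_one_sub (A : Matrix (Fin m) (Fin n) ℝ) :
    (frobNorm A ^ 2 • (1 : Matrix (Fin m) (Fin m) ℝ) - A * Aᵀ).PosSemidef := by
  rw [mul_transpose_eq_sum_vecMulVec, frobNorm_sq, Finset.sum_smul, ← Finset.sum_sub_distrib]
  exact posSemidef_sum _ fun k _ => posSemidef_smul_one_sub_vecMulVec (A.col k)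

/-- The centered contribution of a single sampled column `k` to `A Wᵀ W Aᵀ - A Aᵀ`. -/
noncomputable def columnDeviation (A : Matrix (Fin m) (Fin n) ℝ) (p : Fin n → ℝ) (s : ℕ)
    (k : Fin n) : Matrix (Fin m) (Fin m) ℝ :=
  ((s : ℝ) * p k)⁻¹ • vecMulVec (A.col k) (A.col k) - (s : ℝ)⁻¹ • (A * Aᵀ)

theorem isHermitian_columnDeviation (A : Matrix (Fin m) (Fin n) ℝ) (p : Fin n → ℝ) (s : ℕ)
    (k : Fin n) : (columnDeviation A p s k).IsHermitian :=
  ((posSemidef_vecMulVec_self _).1.real_smul _).sub ((posSemidef_mul_transpose A).1.real_smul _)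

theorem gram_sub_eq_sum_columnDeviation (A : Matrix (Fin m) (Fin n) ℝ) {p : Fin n → ℝ}
    (hp : ∀ k, 0 ≤ p k) {s : ℕ} (hs : 0 < s) (ω : Fin s → Fin n) :
    A * (samplingMatrix p s ω)ᵀ * samplingMatrix p s ω * Aᵀ - A * Aᵀ
      = ∑ i, columnDeviation A p s (ω i) := by
  have hs' : (s : ℝ) ≠ 0 := by positivity
  simp only [columnDeviation, Finset.sum_sub_distrib, samplingMatrix_gram_eq_sum A hp,
    Finset.sum_const, Finset.card_univ, Fintype.card_fin]
  rw [← Nat.cast_smul_eq_nsmul ℝ, smul_smul, mul_inv_cancel₀ hs', one_smul]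

theorem col_eq_zero_of_sum_sq_le {A : Matrix (Fin m) (Fin n) ℝ} {k : Fin n}
    (h : ∑ j, A j k ^ 2 ≤ 0) : A.col k = 0 := by
  have h0 := (Finset.sum_eq_zero_iff_of_nonneg fun j _ => sq_nonneg (A j k)).1
    (le_antisymm h (by positivity))
  ext j
  simpa using h0 j (Finset.mem_univ j)

theorem sum_sq_le_of_le_prob {A : Matrix (Fin m) (Fin n) ℝ} {p : Fin n → ℝ} {β : ℝ}
    (hβ : 0 < β) (hF : 0 < frobNorm A ^ 2) {k : Fin n}
    (hk : β * (∑ j, A j k ^ 2) / frobNorm A ^ 2 ≤ p k) :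
    ∑ j, A j k ^ 2 ≤ frobNorm A ^ 2 / β * p k := by
  rw [div_le_iff₀ hF] at hk
  rw [div_mul_eq_mul_div, le_div_iff₀ hβ]
  linarith

variable {A : Matrix (Fin m) (Fin n) ℝ} {p : Fin n → ℝ} {K : ℝ}

theorem smul_inv_smul_vecMulVec_col (s : ℕ)
    (hK : ∀ k, ∑ j, A j k ^ 2 ≤ K * p k) (k : Fin n) :
    p k • ((s : ℝ) * p k)⁻¹ • vecMulVec (A.col k) (A.col k)
      = (s : ℝ)⁻¹ • vecMulVec (A.col k) (A.col k) := by
  rcases eq_or_ne (p k) 0 with h | h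
  · have hcol : A.col k = 0 := col_eq_zero_of_sum_sq_le (by simpa [h] using hK k)
    simp [hcol]
  · rw [smul_smul, mul_inv, mul_left_comm, mul_inv_cancel₀ h, mul_one]

theorem inv_mul_sum_sq_le (hp : ∀ k, 0 ≤ p k) (hK0 : 0 ≤ K) (s : ℕ)
    (hK : ∀ k, ∑ j, A j k ^ 2 ≤ K * p k) (k : Fin n) :
    ((s : ℝ) * p k)⁻¹ * ∑ j, A j k ^ 2 ≤ K / s := by
  rcases (hp k).eq_or_lt with h | h
  · rw [← h, mul_zero, _root_.inv_zero, zero_mul]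
    positivity
  · calc ((s : ℝ) * p k)⁻¹ * ∑ j, A j k ^ 2 ≤ ((s : ℝ) * p k)⁻¹ * (K * p k) := by
          gcongr
          exact hK k
      _ = K / s := by
          rw [mul_inv]
          field_simp

theorem sum_smul_columnDeviation (hsum : ∑ k, p k = 1) (s : ℕ)
    (hK : ∀ k, ∑ j, A j k ^ 2 ≤ K * p k) : ∑ k, p k • columnDeviation A p s k = 0 := by
  simp only [columnDeviation, smul_sub, smul_inv_smul_vecMulVec_col s hK, Finset.sum_sub_distrib,
    ← Finset.sum_smul, hsum, one_smul, ← Finset.smul_sum]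
  rw [mul_transpose_eq_sum_vecMulVec, sub_self]

theorem posSemidef_smul_one_sub_columnDeviation (hp : ∀ k, 0 ≤ p k) (hK0 : 0 ≤ K) (s : ℕ)
    (hK : ∀ k, ∑ j, A j k ^ 2 ≤ K * p k) (k : Fin n) :
    ((K / s) • (1 : Matrix (Fin m) (Fin m) ℝ) - columnDeviation A p s k).PosSemidef := by
  have hc : 0 ≤ ((s : ℝ) * p k)⁻¹ := inv_nonneg.2 (mul_nonneg s.cast_nonneg (hp k))
  have heq : (K / s) • (1 : Matrix (Fin m) (Fin m) ℝ) - columnDeviation A p s k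
      = (K / s - ((s : ℝ) * p k)⁻¹ * ∑ j, A j k ^ 2) • (1 : Matrix (Fin m) (Fin m) ℝ)
        + ((s : ℝ) * p k)⁻¹ • ((∑ j, A.col k j ^ 2) • (1 : Matrix (Fin m) (Fin m) ℝ)
          - vecMulVec (A.col k) (A.col k)) + (s : ℝ)⁻¹ • (A * Aᵀ) := by
    simp only [columnDeviation, col_apply]
    module
  rw [heq]
  exact ((PosSemidef.one.smul (sub_nonneg.2 (inv_mul_sum_sq_le hp hK0 s hK k))).add
    ((posSemidef_smul_one_sub_vecMulVec _).smul hc)).add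
    ((posSemidef_mul_transpose A).smul (inv_nonneg.2 s.cast_nonneg))

theorem posSemidef_smul_one_add_columnDeviation (hp : ∀ k, 0 ≤ p k) (s : ℕ)
    (hK : frobNorm A ^ 2 ≤ K) (k : Fin n) :
    ((K / s) • (1 : Matrix (Fin m) (Fin m) ℝ) + columnDeviation A p s k).PosSemidef := by
  have hc : 0 ≤ ((s : ℝ) * p k)⁻¹ := inv_nonneg.2 (mul_nonneg s.cast_nonneg (hp k))
  have hs : 0 ≤ (s : ℝ)⁻¹ := inv_nonneg.2 s.cast_nonneg
  have heq : (K / s) • (1 : Matrix (Fin m) (Fin m) ℝ) + columnDeviation A p s k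
      = ((s : ℝ)⁻¹ * (K - frobNorm A ^ 2)) • (1 : Matrix (Fin m) (Fin m) ℝ)
        + (s : ℝ)⁻¹ • (frobNorm A ^ 2 • (1 : Matrix (Fin m) (Fin m) ℝ) - A * Aᵀ)
        + ((s : ℝ) * p k)⁻¹ • vecMulVec (A.col k) (A.col k) := by
    rw [columnDeviation, div_eq_inv_mul]
    module
  rw [heq]
  exact ((PosSemidef.one.smul (mul_nonneg hs (sub_nonneg.2 hK))).add
    ((posSemidef_frobNorm_sq_smul_one_sub A).smul hs)).add
    ((posSemidef_vecMulVec_self _).smul hc)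

theorem posSemidef_smul_sub_sum_columnDeviation_sq (hp : ∀ k, 0 ≤ p k) (hsum : ∑ k, p k = 1)
    (hK0 : 0 ≤ K) (s : ℕ) (hK : ∀ k, ∑ j, A j k ^ 2 ≤ K * p k) :
    ((K / s / s) • (A * Aᵀ)
      - ∑ k, p k • (columnDeviation A p s k * columnDeviation A p s k)).PosSemidef := by
  set B := A * Aᵀ with hB
  have hs : 0 ≤ (s : ℝ)⁻¹ := inv_nonneg.2 s.cast_nonneg
  have hterm : ∀ k, p k • (columnDeviation A p s k * columnDeviation A p s k)
      = ((s : ℝ)⁻¹ * (((s : ℝ) * p k)⁻¹ * ∑ j, A j k ^ 2)) • vecMulVec (A.col k) (A.col k)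
        - ((s : ℝ)⁻¹ * (s : ℝ)⁻¹) • (vecMulVec (A.col k) (A.col k) * B)
        - ((s : ℝ)⁻¹ * (s : ℝ)⁻¹) • (B * vecMulVec (A.col k) (A.col k))
        + (p k * ((s : ℝ)⁻¹ * (s : ℝ)⁻¹)) • (B * B) := fun k => by
    have hC := smul_inv_smul_vecMulVec_col s hK k
    have hCC := vecMulVec_self_mul_self (A.col k)
    simp only [col_apply] at hCC
    rw [columnDeviation, ← hB]
    set C := vecMulVec (A.col k) (A.col k)
    set c := ((s : ℝ) * p k)⁻¹
    calc p k • ((c • C - (s : ℝ)⁻¹ • B) * (c • C - (s : ℝ)⁻¹ • B))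
        = (c * ∑ j, A j k ^ 2) • (p k • c • C) - (s : ℝ)⁻¹ • ((p k • c • C) * B)
          - (s : ℝ)⁻¹ • (B * (p k • c • C)) + (p k * ((s : ℝ)⁻¹ * (s : ℝ)⁻¹)) • (B * B) := by
          simp only [sub_mul, mul_sub, Matrix.smul_mul, Matrix.mul_smul, hCC]
          module
      _ = _ := by
          rw [hC]
          simp only [Matrix.smul_mul, Matrix.mul_smul]
          module
  have hsumC : ∑ k, vecMulVec (A.col k) (A.col k) = B := (mul_transpose_eq_sum_vecMulVec A).symm
  have heq : (K / s / s) • B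
      - ∑ k, p k • (columnDeviation A p s k * columnDeviation A p s k)
      = ∑ k, ((s : ℝ)⁻¹ * (K / s - ((s : ℝ) * p k)⁻¹ * ∑ j, A j k ^ 2))
          • vecMulVec (A.col k) (A.col k) + ((s : ℝ)⁻¹ * (s : ℝ)⁻¹) • (B * Bᵀ) := by
    have hBT : Bᵀ = B := by simp [hB]
    simp only [hterm, Finset.sum_add_distrib, Finset.sum_sub_distrib, ← Finset.smul_sum,
      ← Finset.sum_mul, ← Finset.mul_sum, ← Finset.sum_smul, hsumC, hsum, hBT, mul_sub, sub_smul,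
      div_eq_inv_mul]
    module
  rw [heq]
  exact (posSemidef_sum _ fun k _ => (posSemidef_vecMulVec_self _).smul
    (mul_nonneg hs (sub_nonneg.2 (inv_mul_sum_sq_le hp hK0 s hK k)))).add
    ((posSemidef_mul_transpose B).smul (mul_nonneg hs hs))

end ColumnSampling

theorem le_of_mul_cosh_sub_one_le {q F δ l : ℝ} (hF : 0 < F) (hδ0 : 0 < δ) (hδ1 : δ < 1)
    (hl : Real.log (4 * (1 + F) / δ) ≤ l)
    (hq : q * (Real.cosh (2 * l) - 1) ≤ F * (Real.exp l - 1)) : q ≤ δ := by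
  have hz : 4 * (1 + F) / δ ≤ Real.exp l := by
    rwa [← Real.log_le_iff_le_exp (by positivity)]
  rw [div_le_iff₀ hδ0] at hz
  by_contra! hlt
  set z := Real.exp l with hzdef
  have hz0 : 0 < z := Real.exp_pos l
  have hz1 : 1 < z := by nlinarith
  have hcosh : Real.cosh (2 * l) - 1 = (z ^ 2 - 1) ^ 2 / (2 * z ^ 2) := by
    rw [Real.cosh_eq, Real.exp_neg, two_mul, Real.exp_add, ← hzdef]
    field_simp
    ring
  rw [hcosh, ← mul_div_assoc, div_le_iff₀ (by positivity)] at hq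
  have hpos : 0 < (z ^ 2 - 1) ^ 2 := by
    have : 0 < z ^ 2 - 1 := by nlinarith
    positivity
  have h1 : δ * (z ^ 2 - 1) ^ 2 < F * (z - 1) * (2 * z ^ 2) :=
    (mul_lt_mul_of_pos_right hlt hpos).trans_le hq
  have h2 : δ * ((z - 1) * (z + 1) ^ 2) < F * (2 * z ^ 2) := by
    refine lt_of_mul_lt_mul_left ?_ (sub_pos.2 hz1).le
    linarith
  have h3 : 2 * F ≤ δ * (z - 1) := by nlinarith
  have h4 : F * (2 * z ^ 2) ≤ δ * ((z - 1) * (z + 1) ^ 2) :=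
    calc F * (2 * z ^ 2) = 2 * F * z ^ 2 := by ring
      _ ≤ δ * (z - 1) * (z + 1) ^ 2 := by
          gcongr
          linarith
      _ = _ := by ring
  linarith

/-- spectral-norm concentration for sampled Gram matrices. -/
theorem stmt_8 {m n : ℕ} (s : ℕ) (hs : 0 < s)
    (A : Matrix (Fin m) (Fin n) ℝ) (hA2 : specNorm A ≤ 1)
    (β : ℝ) (hβ0 : 0 < β) (hβ1 : β ≤ 1)
    (p : Fin n → ℝ) (hp : ∀ i, 0 ≤ p i) (hsum : ∑ i, p i = 1)
    (hpi : ∀ i, β * (∑ j, (A j i) ^ 2) / frobNorm A ^ 2 ≤ p i)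
    (δ ε : ℝ) (hδ0 : 0 < δ) (hδ1 : δ < 1) (hε : 0 < ε)
    (hsbig : (s : ℝ) ≥ 2 * (1 + ε / 3) * (frobNorm A ^ 2 / (β * ε ^ 2))
        * Real.log (4 * (1 + frobNorm A ^ 2) / δ)) :
    probOf p (fun (ω : Fin s → Fin n) =>
      specNorm (A * (samplingMatrix p s ω)ᵀ * samplingMatrix p s ω * Aᵀ - A * Aᵀ) ≤ ε)
    ≥ 1 - δ := by
  rcases (sq_nonneg (frobNorm A)).eq_or_lt with hF | hF
  · have hA : A = 0 := by
      ext j k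
      have hcol := (Finset.sum_eq_zero_iff_of_nonneg fun k _ =>
        Finset.sum_nonneg fun j _ => sq_nonneg (A j k)).1 ((frobNorm_sq A).symm.trans hF.symm) k
        (Finset.mem_univ k)
      exact congrFun (col_eq_zero_of_sum_sq_le hcol.le) j
    have hnorm : specNorm (0 : Matrix (Fin m) (Fin m) ℝ) ≤ ε := by simpa [specNorm] using hε.le
    simp only [hA, Matrix.zero_mul, sub_zero, probOf, hnorm, if_true,
      sum_prod_apply_eq_one hsum]
    linarith
  · have hs' : (0 : ℝ) < s := Nat.cast_pos.2 hs
    set K := frobNorm A ^ 2 / β with hKdef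
    have hK0 : 0 < K := by positivity
    have hFK : frobNorm A ^ 2 ≤ K := le_div_self hF.le hβ0 hβ1
    have hK : ∀ k, ∑ j, A j k ^ 2 ≤ K * p k := fun k => sum_sq_le_of_le_prob hβ0 hF (hpi k)
    set l := ε ^ 2 * s / (2 * K * (1 + ε / 3)) with hl
    set θ := ε * s / (K * (1 + ε / 3)) with hθ
    have hθK : θ * (K / s) = ε / (1 + ε / 3) := by
      rw [hθ]
      field_simp
    have hθlt : θ * (K / s) < 3 := by
      rw [hθK, div_lt_iff₀ (by positivity)]
      linarith
    have hmain := one_sub_probOf_specNorm_sum_mul_le (s := s) hp hsum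
      (isHermitian_columnDeviation A p s) (sum_smul_columnDeviation hsum s hK)
      (posSemidef_smul_one_sub_columnDeviation hp hK0.le s hK)
      (posSemidef_smul_one_add_columnDeviation hp s hFK) (posSemidef_mul_transpose A)
      (posSemidef_one_sub_mul_transpose hA2)
      (posSemidef_smul_sub_sum_columnDeviation_sq hp hsum hK0.le s hK)
      (θ := θ) (by positivity) hθlt hε.le
    have hexp : (s : ℝ) * (1 / (2 * (1 - θ * (K / s) / 3)) * (θ ^ 2 * (K / s / s))) = l := by
      have hden : 1 - θ * (K / s) / 3 = 1 / (1 + ε / 3) := by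
        rw [hθK]
        field_simp
        ring
      rw [hden, hθ, hl]
      field_simp
    have hθε : θ * ε = 2 * l := by
      rw [hθ, hl]
      field_simp
    have hlog : Real.log (4 * (1 + frobNorm A ^ 2) / δ) ≤ l := by
      rw [hl, le_div_iff₀ (by positivity)]
      calc Real.log (4 * (1 + frobNorm A ^ 2) / δ) * (2 * K * (1 + ε / 3))
          = ε ^ 2 * (2 * (1 + ε / 3) * (frobNorm A ^ 2 / (β * ε ^ 2))
            * Real.log (4 * (1 + frobNorm A ^ 2) / δ)) := by
            rw [hKdef]
            field_simp
        _ ≤ ε ^ 2 * s := by gcongr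
    rw [hexp, hθε, trace_mul_transpose] at hmain
    simp only [gram_sub_eq_sum_columnDeviation A hp hs]
    linarith [le_of_mul_cosh_sub_one_le hF hδ0 hδ1 hlog hmain]
end

section
/- Let A ∈ ℝ^{n×d} have thin SVD A = UΣVᵀ, let 1 ≤ k < rank(A), let U_k consist of the top k left singular vectors, and let A_{k,⊥} = A − A_k. Define sampling probabilities p_i = (1/2)‖(U_k)_{i*}‖₂²/k + (1/2)‖(A_{k,⊥})_{i*}‖₂²/‖A_{k,⊥}‖_F², and let W ∈ ℝ^{s×n} be the random sampling-and-rescaling matrix of Algorithm 1 built from these probabilities. Let ε ∈ (0,1) and δ ∈ (0,1). If s ≥ max{ (1 + ε/3) · 4k ln(16(1+k)/δ)/ε² , 8k/(δ ε²) }, then with probability at least 1 − δ, for every matrix X ∈ ℝ^{d×(d−k)} with XᵀX = I_{d−k}: |‖WAX‖_F² − ‖AX‖_F²| ≤ 5 ε ‖AX‖_F². -/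
open Matrix BigOperators

open Filter Topology

section NormedAlgebra
variable {𝔸 : Type*} [NormedRing 𝔸] [NormOneClass 𝔸]

theorem norm_normedSpace_exp_le [NormedAlgebra ℝ 𝔸] (x : 𝔸) :
    ‖NormedSpace.exp x‖ ≤ Real.exp ‖x‖ := by
  rw [NormedSpace.exp_eq_tsum ℝ]
  refine tsum_of_norm_bounded (g := fun n => ‖x‖ ^ n / (n.factorial : ℝ)) ?_ fun n => ?_
  · rw [Real.exp_eq_exp_ℝ]
    exact NormedSpace.expSeries_div_hasSum_exp ‖x‖
  · rw [norm_smul, norm_inv, Real.norm_natCast, div_eq_inv_mul]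
    gcongr
    exact norm_pow_le x n

theorem norm_pow_sub_pow_le {x y : 𝔸} {C : ℝ} (hC : 1 ≤ C) (hx : ‖x‖ ≤ C) (hy : ‖y‖ ≤ C) (N : ℕ) :
    ‖x ^ N - y ^ N‖ ≤ N * C ^ N * ‖x - y‖ := by
  induction N with
  | zero => simp
  | succ N ih =>
    have e : x ^ (N + 1) - y ^ (N + 1) = x ^ N * (x - y) + (x ^ N - y ^ N) * y := by
      simp only [pow_succ]; noncomm_ring
    have h1 : ‖x ^ N * (x - y)‖ ≤ C ^ (N + 1) * ‖x - y‖ := by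
      refine (norm_mul_le _ _).trans ?_
      gcongr
      calc ‖x ^ N‖ ≤ ‖x‖ ^ N := norm_pow_le _ _
        _ ≤ C ^ N := by gcongr
        _ ≤ C ^ (N + 1) := pow_le_pow_right₀ hC (Nat.le_succ _)
    have h2 : ‖(x ^ N - y ^ N) * y‖ ≤ N * C ^ N * ‖x - y‖ * C := by
      refine (norm_mul_le _ _).trans ?_
      gcongr
    rw [e]
    refine (norm_add_le _ _).trans ((add_le_add h1 h2).trans_eq ?_)
    push_cast
    ring

/-- The Lie–Trotter product formula. -/
theorem tendsto_exp_mul_exp_pow [NormedAlgebra ℝ 𝔸] [CompleteSpace 𝔸] (a b : 𝔸) :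
    Tendsto (fun N : ℕ => (NormedSpace.exp ((N : ℝ)⁻¹ • a) * NormedSpace.exp ((N : ℝ)⁻¹ • b)) ^ N)
      atTop (𝓝 (NormedSpace.exp (a + b))) := by
  set g : ℝ → 𝔸 := fun t =>
    NormedSpace.exp (t • a) * NormedSpace.exp (t • b) - NormedSpace.exp (t • (a + b)) with hg
  have hg0 : g 0 = 0 := by simp [hg]
  have hderiv : HasDerivAt g 0 0 := by
    have h := ((hasDerivAt_exp_smul_const a (0 : ℝ)).mul (hasDerivAt_exp_smul_const b (0 : ℝ))).sub
      (hasDerivAt_exp_smul_const (a + b) (0 : ℝ))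
    convert! h using 1
    simp
  have hlim : Tendsto (fun N : ℕ => (N : ℝ) * ‖g ((N : ℝ)⁻¹)‖) atTop (𝓝 0) := by
    have h1 := (hasDerivAt_iff_tendsto.mp hderiv).comp (tendsto_inv_atTop_nhds_zero_nat (𝕜 := ℝ))
    refine h1.congr' ?_
    filter_upwards with N
    simp [hg0]
  rw [tendsto_iff_norm_sub_tendsto_zero]
  set M := ‖a‖ + ‖b‖ with hM
  have hlim2 := hlim.const_mul (Real.exp M)
  rw [mul_zero] at hlim2
  refine squeeze_zero' (Eventually.of_forall fun _ => norm_nonneg _) ?_ hlim2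
  filter_upwards [eventually_gt_atTop 0] with N hN
  have hN' : (0 : ℝ) < N := by exact_mod_cast hN
  let +nondep : NormedAlgebra ℚ 𝔸 := .restrictScalars ℚ ℝ 𝔸
  have hpow : NormedSpace.exp (a + b) = NormedSpace.exp ((N : ℝ)⁻¹ • (a + b)) ^ N := by
    rw [← NormedSpace.exp_nsmul, ← Nat.cast_smul_eq_nsmul ℝ, smul_smul, mul_inv_cancel₀ hN'.ne',
      one_smul]
  have hx : ‖NormedSpace.exp ((N : ℝ)⁻¹ • a) * NormedSpace.exp ((N : ℝ)⁻¹ • b)‖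
      ≤ Real.exp ((N : ℝ)⁻¹ * M) := by
    rw [hM, mul_add, Real.exp_add]
    refine (norm_mul_le _ _).trans (mul_le_mul ?_ ?_ (norm_nonneg _) (Real.exp_nonneg _))
    all_goals
      refine (norm_normedSpace_exp_le _).trans_eq ?_
      rw [norm_smul, norm_inv, Real.norm_natCast]
  have hy : ‖NormedSpace.exp ((N : ℝ)⁻¹ • (a + b))‖ ≤ Real.exp ((N : ℝ)⁻¹ * M) := by
    refine (norm_normedSpace_exp_le _).trans ?_
    rw [norm_smul, norm_inv, Real.norm_natCast]
    gcongr
    exact norm_add_le a b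
  rw [hpow]
  refine (norm_pow_sub_pow_le (Real.one_le_exp (by positivity)) hx hy N).trans_eq ?_
  rw [← Real.exp_nat_mul, mul_inv_cancel_left₀ hN'.ne']
  ring
end NormedAlgebra

theorem abs_trace_mul_le {m n : Type*} [Fintype m] [Fintype n] (Z : Matrix m n ℝ)
    (W : Matrix n m ℝ) (M : ℝ)
    (hZ : trace (Zᵀ * Z) ≤ M) (hW : trace (Wᵀ * W) ≤ M) : |trace (Z * W)| ≤ M := by
  have h1 : trace (Zᵀ * Z) = ∑ i, ∑ j, Z i j ^ 2 := by
    simp only [trace, diag, mul_apply, transpose_apply, ← sq]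
    exact Finset.sum_comm
  have h2 : trace (Wᵀ * W) = ∑ i, ∑ j, W j i ^ 2 := by
    simp only [trace, diag, mul_apply, transpose_apply, ← sq]
  have h3 : trace (Z * W) = ∑ i, ∑ j, Z i j * W j i := by
    simp only [trace, diag, mul_apply]
  rw [h1] at hZ
  rw [h2] at hW
  rw [h3, abs_le]
  have key1 : ∑ i, ∑ j, 2 * (Z i j * W j i) ≤ ∑ i, ∑ j, (Z i j ^ 2 + W j i ^ 2) :=
    Finset.sum_le_sum fun i _ => Finset.sum_le_sum fun j _ => by
      nlinarith [sq_nonneg (Z i j - W j i)]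
  have key2 : ∑ i, ∑ j, (-2) * (Z i j * W j i) ≤ ∑ i, ∑ j, (Z i j ^ 2 + W j i ^ 2) :=
    Finset.sum_le_sum fun i _ => Finset.sum_le_sum fun j _ => by
      nlinarith [sq_nonneg (Z i j + W j i)]
  simp only [Finset.sum_add_distrib, ← Finset.mul_sum] at key1 key2
  constructor <;> linarith

section MatrixExponential
variable {m : Type*} [Fintype m] [DecidableEq m]

theorem trace_mul_pow_comm (A B : Matrix m m ℝ) (q : ℕ) :
    trace ((A * B) ^ q) = trace ((B * A) ^ q) := by
  cases q with
  | zero => simp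
  | succ q => rw [pow_succ, ← mul_assoc, mul_pow_mul, trace_mul_comm, ← mul_assoc, ← pow_succ']

theorem abs_trace_mul_pow_le (j : ℕ) : ∀ (Z W : Matrix m m ℝ) (M : ℝ),
    trace ((Zᵀ * Z) ^ 2 ^ j) ≤ M → trace ((Wᵀ * W) ^ 2 ^ j) ≤ M →
    |trace ((Z * W) ^ 2 ^ j)| ≤ M := by
  induction j with
  | zero =>
    intro Z W M hZ hW
    simp only [pow_zero, pow_one] at *
    exact abs_trace_mul_le Z W M hZ hW
  | succ j ih =>
    intro Z W M hZ hW
    have hle : trace (((Z * W)ᵀ * (Z * W)) ^ 2 ^ j) ≤ M := by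
      have e : trace (((Z * W)ᵀ * (Z * W)) ^ 2 ^ j) = trace (((Zᵀ * Z) * (W * Wᵀ)) ^ 2 ^ j) := by
        rw [transpose_mul, mul_assoc Wᵀ, trace_mul_pow_comm]
        simp only [mul_assoc]
      rw [e]
      refine (le_abs_self _).trans (ih _ _ _ ?_ ?_)
      · rw [transpose_mul, transpose_transpose, ← sq, ← pow_mul, ← pow_succ']
        exact hZ
      · rw [transpose_mul, transpose_transpose, ← sq, ← pow_mul, ← pow_succ', trace_mul_pow_comm]
        exact hW
    have := ih (Z * W) (Z * W) M hle hle
    rwa [← sq, ← pow_mul, ← pow_succ'] at this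

theorem trace_mul_pow_le (j : ℕ) : ∀ (A B : Matrix m m ℝ), Aᵀ = A → Bᵀ = B →
    trace ((A * B) ^ 2 ^ j) ≤ trace (A ^ 2 ^ j * B ^ 2 ^ j) := by
  induction j with
  | zero => intro A B _ _; simp
  | succ j ih =>
    intro A B hA hB
    have h := (le_abs_self _).trans
      (abs_trace_mul_pow_le j (A * B) (A * B) _ le_rfl le_rfl)
    have e : trace (((A * B)ᵀ * (A * B)) ^ 2 ^ j) = trace ((A ^ 2 * B ^ 2) ^ 2 ^ j) := by
      rw [transpose_mul, mul_assoc Bᵀ, trace_mul_pow_comm, hA, hB]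
      simp only [mul_assoc, sq]
    have h2 := ih (A ^ 2) (B ^ 2) (by rw [transpose_pow, hA]) (by rw [transpose_pow, hB])
    rw [e, ← sq, ← pow_mul, ← pow_succ'] at h
    rw [← pow_mul, ← pow_mul, ← pow_succ'] at h2
    exact h.trans h2

open scoped Matrix.Norms.L2Operator in
theorem tendsto_matrix_exp_mul_exp_pow [Nonempty m] (A B : Matrix m m ℝ) :
    Tendsto (fun N : ℕ => (NormedSpace.exp ((N : ℝ)⁻¹ • A) * NormedSpace.exp ((N : ℝ)⁻¹ • B)) ^ N)
      atTop (𝓝 (NormedSpace.exp (A + B))) :=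
  tendsto_exp_mul_exp_pow A B

/-- The Golden–Thompson inequality for real symmetric matrices. -/
theorem golden_thompson [Nonempty m] (A B : Matrix m m ℝ) (hA : Aᵀ = A) (hB : Bᵀ = B) :
    trace (NormedSpace.exp (A + B)) ≤ trace (NormedSpace.exp A * NormedSpace.exp B) := by
  have h1 := (tendsto_matrix_exp_mul_exp_pow A B).comp
    (tendsto_pow_atTop_atTop_of_one_lt (r := 2) (by norm_num))
  have h2 : Continuous fun M : Matrix m m ℝ => trace M := continuous_id.matrix_trace
  refine le_of_tendsto ((h2.tendsto _).comp h1) (Eventually.of_forall fun j => ?_)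
  have hroot : ∀ C : Matrix m m ℝ,
      NormedSpace.exp (((2 ^ j : ℕ) : ℝ)⁻¹ • C) ^ 2 ^ j = NormedSpace.exp C := by
    intro C
    rw [← Matrix.exp_nsmul, ← Nat.cast_smul_eq_nsmul ℝ, smul_smul, mul_inv_cancel₀ (by positivity),
      one_smul]
  have h3 := trace_mul_pow_le j (NormedSpace.exp (((2 ^ j : ℕ) : ℝ)⁻¹ • A))
    (NormedSpace.exp (((2 ^ j : ℕ) : ℝ)⁻¹ • B)) (by rw [← exp_transpose, transpose_smul, hA])
    (by rw [← exp_transpose, transpose_smul, hB])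
  rwa [hroot, hroot] at h3

/-- The exponential of a multiple of a rank-one matrix `v vᵀ`. -/
theorem exp_smul_vecMulVec_self (θ : ℝ) (v : m → ℝ) (hv : v ⬝ᵥ v ≠ 0) :
    NormedSpace.exp (θ • vecMulVec v v) =
      1 + ((Real.exp (θ * (v ⬝ᵥ v)) - 1) / (v ⬝ᵥ v)) • vecMulVec v v := by
  set P := vecMulVec v v with hP
  set c := v ⬝ᵥ v with hc
  have hpow : ∀ n : ℕ, P ^ (n + 1) = c ^ n • P := by
    intro n
    induction n with
    | zero => simp
    | succ n ih =>
      rw [pow_succ, ih, smul_mul_assoc, hP, vecMulVec_mul_vecMulVec, pow_succ, mul_smul]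
      congr 1
      ext i j
      simp [vecMulVec_apply, ← hc]
      try ring
  have hterm : ∀ n : ℕ, ((n.factorial : ℝ)⁻¹) • (θ • P) ^ n =
      (((θ * c) ^ n / n.factorial) • (c⁻¹ • P)) + (if n = 0 then 1 - c⁻¹ • P else 0) := by
    intro n
    cases n with
    | zero => simp
    | succ n =>
      rw [smul_pow, hpow, smul_smul, smul_smul, smul_smul, if_neg (Nat.succ_ne_zero n), add_zero]
      congr 1
      field_simp
      ring
  have hsum : HasSum (fun n : ℕ => ((n.factorial : ℝ)⁻¹) • (θ • P) ^ n)
      (Real.exp (θ * c) • (c⁻¹ • P) + (1 - c⁻¹ • P)) := by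
    simp only [hterm]
    refine HasSum.add (HasSum.smul_const ?_ _) (hasSum_ite_eq 0 _)
    rw [Real.exp_eq_exp_ℝ]
    exact NormedSpace.expSeries_div_hasSum_exp (θ * c)
  rw [NormedSpace.exp_eq_tsum ℝ]
  refine hsum.tsum_eq.trans ?_
  rw [div_eq_mul_inv, mul_smul, sub_smul, one_smul]
  abel

theorem exp_dotProduct_le_trace_exp (S : Matrix m m ℝ) (hS : Sᵀ = S) (x : m → ℝ) (hx : x ⬝ᵥ x = 1) :
    Real.exp (x ⬝ᵥ S *ᵥ x) ≤ trace (NormedSpace.exp S) := by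
  have hH : S.IsHermitian := by rw [IsHermitian, conjTranspose_eq_transpose_of_trivial, hS]
  set Q : Matrix m m ℝ := hH.eigenvectorUnitary.1 with hQ
  have hQQ : Qᵀ * Q = 1 := by
    have := Unitary.coe_star_mul_self hH.eigenvectorUnitary
    rwa [star_eq_conjTranspose, conjTranspose_eq_transpose_of_trivial] at this
  have hQQ' : Q * Qᵀ = 1 := mul_eq_one_comm.mp hQQ
  have hspec : S = Q * diagonal hH.eigenvalues * Qᵀ := by
    conv_lhs => rw [hH.spectral_theorem]
    simp [Unitary.conjStarAlgAut_apply, star_eq_conjTranspose, hQ]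
  have hinv : Q⁻¹ = Qᵀ := inv_eq_left_inv hQQ
  have hexp : NormedSpace.exp S = Q * diagonal (fun i => Real.exp (hH.eigenvalues i)) * Qᵀ := by
    conv_lhs => rw [hspec]
    rw [← hinv, exp_conj _ _ (IsUnit.of_mul_eq_one _ hQQ'), exp_diagonal]
    congr 3
    funext i
    rw [Pi.coe_exp, Real.exp_eq_exp_ℝ]
  have htr : trace (NormedSpace.exp S) = ∑ i, Real.exp (hH.eigenvalues i) := by
    rw [hexp, trace_mul_comm, ← mul_assoc, hQQ, one_mul, trace_diagonal]
  set y := Qᵀ *ᵥ x with hy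
  have hyy : ∑ i, y i ^ 2 = 1 := by
    have : y ⬝ᵥ y = 1 := by
      rw [hy, dotProduct_mulVec, vecMul_transpose, mulVec_mulVec, hQQ', one_mulVec, hx]
    simpa [dotProduct, sq] using this
  have hxs : x ⬝ᵥ S *ᵥ x = ∑ i, y i ^ 2 * hH.eigenvalues i := by
    conv_lhs => rw [hspec]
    rw [← mulVec_mulVec, ← mulVec_mulVec, dotProduct_mulVec, ← mulVec_transpose, ← hy]
    simp only [dotProduct, mulVec_diagonal]
    exact Finset.sum_congr rfl fun i _ => by ring
  rw [htr, hxs]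
  have hj := convexOn_exp.map_sum_le (t := Finset.univ) (w := fun i => y i ^ 2)
    (p := hH.eigenvalues) (fun i _ => sq_nonneg _) hyy (fun i _ => Set.mem_univ _)
  simp only [smul_eq_mul] at hj
  refine hj.trans (Finset.sum_le_sum fun i hi => ?_)
  have : y i ^ 2 ≤ 1 :=
    hyy ▸ Finset.single_le_sum (f := fun i => y i ^ 2) (fun i _ => sq_nonneg _) hi
  nlinarith [Real.exp_pos (hH.eigenvalues i)]

theorem dotProduct_exp_mulVec_nonneg (S : Matrix m m ℝ) (hS : Sᵀ = S) (x : m → ℝ) :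
    0 ≤ x ⬝ᵥ NormedSpace.exp S *ᵥ x := by
  have h : NormedSpace.exp S =
    NormedSpace.exp ((2 : ℝ)⁻¹ • S) * NormedSpace.exp ((2 : ℝ)⁻¹ • S) := by
    rw [← Matrix.exp_add_of_commute _ _ (Commute.refl _), ← two_smul ℝ, smul_smul]
    norm_num
  have ht : (NormedSpace.exp ((2 : ℝ)⁻¹ • S))ᵀ = NormedSpace.exp ((2 : ℝ)⁻¹ • S) := by
    rw [← exp_transpose, transpose_smul, hS]
  rw [h, ← mulVec_mulVec, dotProduct_mulVec, ← mulVec_transpose, ht]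
  exact Finset.sum_nonneg fun i _ => mul_self_nonneg _
end MatrixExponential

section Scalar

theorem sq_div_le_one_add_mul_log {x : ℝ} (hx : 0 ≤ x) :
    x ^ 2 / (2 * (1 + x / 3)) ≤ (1 + x) * Real.log (1 + x) - x := by
  set y := x / (2 + x) with hy
  have hy0 : 0 ≤ y := by positivity
  have hy1 : y < 1 := by rw [hy, div_lt_one (by positivity)]; linarith
  have hxy : x = 2 * y / (1 - y) := by
    rw [hy]; field_simp; ring
  have hden : 0 < 1 - y := by linarith
  have hq : 1 + x = (1 + y) / (1 - y) := by rw [hxy]; field_simp; ring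
  have hlog : 2 * (y + y ^ 3 / 3) ≤ Real.log (1 + x) := by
    have h := Real.sum_range_le_log_div hy0 hy1 2
    rw [← hq] at h
    simp only [Finset.sum_range_succ, Finset.sum_range_zero] at h
    norm_num at h
    linarith
  have h1 : (1 + x) * (2 * (y + y ^ 3 / 3)) ≤ (1 + x) * Real.log (1 + x) := by gcongr
  refine le_trans ?_ (sub_le_sub_right h1 x)
  have e1 : x ^ 2 / (2 * (1 + x / 3)) = (2 * y ^ 2 / (1 - y / 3)) / (1 - y) := by
    have : 1 - y / 3 ≠ 0 := by linarith
    have : 1 + x / 3 = (1 - y / 3) / (1 - y) := by rw [hxy]; field_simp; ring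
    rw [this, hxy]; field_simp
  have e2 : (1 + x) * (2 * (y + y ^ 3 / 3)) - x
      = (2 * y ^ 2 + 2 * y ^ 3 / 3 + 2 * y ^ 4 / 3) / (1 - y) := by
    rw [hq, hxy]; field_simp; ring
  rw [e1, e2]
  gcongr
  rw [div_le_iff₀ (by linarith)]
  nlinarith [pow_nonneg hy0 4, pow_nonneg hy0 2, mul_nonneg (pow_nonneg hy0 4) hden.le]

theorem sq_div_le_one_sub_mul_log {x : ℝ} (hx : 0 ≤ x) (hx1 : x < 1) :
    x ^ 2 / (2 * (1 + x / 3)) ≤ (1 - x) * Real.log (1 - x) + x := by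
  have h0 : 0 < 1 - x := by linarith
  have h1 : -Real.log (1 - x) ≤ ((1 - x)⁻¹ - (1 - x)) / 2 := by
    have hinv : 0 ≤ Real.log (1 - x)⁻¹ := Real.log_nonneg (one_le_inv_iff₀.mpr ⟨h0, by linarith⟩)
    have h := Real.self_le_sinh_iff.mpr hinv
    rwa [Real.sinh_log (inv_pos.mpr h0), inv_inv, Real.log_inv] at h
  have h2 : (1 - x) * -Real.log (1 - x) ≤ (1 - x) * (((1 - x)⁻¹ - (1 - x)) / 2) := by gcongr
  have h3 : (1 - x) * (((1 - x)⁻¹ - (1 - x)) / 2) = x - x ^ 2 / 2 := by field_simp; ring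
  have h4 : x ^ 2 / (2 * (1 + x / 3)) ≤ x ^ 2 / 2 := by
    gcongr; linarith
  linarith

theorem exp_mul_sub_one_div_le {θ c L : ℝ} (hc : 0 < c) (hcL : c ≤ L) :
    (Real.exp (θ * c) - 1) / c ≤ (Real.exp (θ * L) - 1) / L := by
  have hL : 0 < L := hc.trans_le hcL
  have h := convexOn_exp.2 (Set.mem_univ (θ * L)) (Set.mem_univ 0)
    (show 0 ≤ c / L by positivity) (show 0 ≤ 1 - c / L by rw [sub_nonneg, div_le_one hL]; exact hcL)
    (by ring)
  simp only [smul_eq_mul, mul_zero, add_zero, Real.exp_zero, mul_one] at h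
  have e : c / L * (θ * L) = θ * c := by field_simp
  rw [e] at h
  rw [div_le_div_iff₀ hc hL]
  have h' := mul_le_mul_of_nonneg_right h hL.le
  have e2 : (c / L * Real.exp (θ * L) + (1 - c / L)) * L = c * Real.exp (θ * L) + (L - c) := by
    field_simp
  rw [e2] at h'
  linarith
end Scalar

section Expectation

theorem expec_zero {n : ℕ} (p : Fin n → ℝ) (f : (Fin 0 → Fin n) → ℝ) :
    expec p f = f Fin.elim0 := by
  simp [expec, Subsingleton.elim default (Fin.elim0 : Fin 0 → Fin n)]

theorem expec_succ {n s : ℕ} (p : Fin n → ℝ) (f : (Fin (s + 1) → Fin n) → ℝ) :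
    expec p f = ∑ i, p i * expec p fun ω : Fin s → Fin n => f (Fin.cons i ω) := by
  unfold expec
  rw [← (Fin.consEquiv fun _ => Fin n).sum_comp, Fintype.sum_prod_type]
  refine Finset.sum_congr rfl fun i _ => ?_
  rw [Finset.mul_sum]
  refine Finset.sum_congr rfl fun ω _ => ?_
  simp [Fin.consEquiv, Fin.prod_univ_succ, mul_assoc]

theorem expec_add {n s : ℕ} (p : Fin n → ℝ) (f g : (Fin s → Fin n) → ℝ) :
    expec p (fun ω => f ω + g ω) = expec p f + expec p g := by
  simp [expec, mul_add, Finset.sum_add_distrib]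

theorem expec_const_mul {n s : ℕ} (p : Fin n → ℝ) (c : ℝ) (f : (Fin s → Fin n) → ℝ) :
    expec p (fun ω => c * f ω) = c * expec p f := by
  simp [expec, Finset.mul_sum, mul_left_comm]

theorem expec_sum {n s : ℕ} {ι : Type*} (t : Finset ι) (p : Fin n → ℝ)
    (f : ι → (Fin s → Fin n) → ℝ) :
    expec p (fun ω => ∑ a ∈ t, f a ω) = ∑ a ∈ t, expec p (f a) := by
  simp only [expec, Finset.mul_sum]
  exact Finset.sum_comm

theorem expec_mono {n s : ℕ} {p : Fin n → ℝ} (hp : ∀ i, 0 ≤ p i) {f g : (Fin s → Fin n) → ℝ}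
    (h : ∀ ω, f ω ≤ g ω) : expec p f ≤ expec p g :=
  Finset.sum_le_sum fun ω _ =>
    mul_le_mul_of_nonneg_left (h ω) (Finset.prod_nonneg fun _ _ => hp _)

theorem expec_const {n s : ℕ} {p : Fin n → ℝ} (hp1 : ∑ i, p i = 1) (c : ℝ) :
    expec p (fun _ : Fin s → Fin n => c) = c := by
  induction s with
  | zero => rw [expec_zero]
  | succ s ih => rw [expec_succ]; simp only [ih, ← Finset.sum_mul, hp1, one_mul]

/-- The Markov inequality in complementary form. -/
theorem one_sub_le_probOf {n s : ℕ} {p : Fin n → ℝ} (hp : ∀ i, 0 ≤ p i) (hp1 : ∑ i, p i = 1)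
    {E : (Fin s → Fin n) → Prop} {f : (Fin s → Fin n) → ℝ} (hf : ∀ ω, 0 ≤ f ω)
    (hE : ∀ ω, f ω < 1 → E ω) : 1 - expec p f ≤ probOf p E := by
  classical
  have h : expec p (fun _ : Fin s → Fin n => (1 : ℝ)) ≤
      expec p (fun ω => (if E ω then 1 else 0) + f ω) := by
    refine expec_mono hp fun ω => ?_
    by_cases hω : E ω
    · simp [hω, hf ω]
    · simpa [hω] using not_lt.mp (mt (hE ω) hω)
  rw [expec_const hp1, expec_add] at h
  have e : expec p (fun ω => if E ω then 1 else 0) = probOf p E := by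
    simp [expec, probOf]
  linarith

theorem expec_sq_sum_of_centered {n s : ℕ} {p : Fin n → ℝ} {g : Fin n → ℝ}
    (hg : ∑ i, p i * g i = 0) (hp1 : ∑ i, p i = 1) :
    expec p (fun ω : Fin s → Fin n => (∑ j, g (ω j)) ^ 2) = s * ∑ i, p i * g i ^ 2 := by
  induction s with
  | zero => simp [expec_zero]
  | succ s ih =>
    rw [expec_succ]
    have h : ∀ i, expec p (fun ω : Fin s → Fin n =>
        (∑ j, g ((Fin.cons i ω : Fin (s + 1) → Fin n) j)) ^ 2) =
        g i ^ 2 + 2 * g i * expec p (fun ω : Fin s → Fin n => ∑ j, g (ω j))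
          + s * ∑ i, p i * g i ^ 2 := by
      intro i
      rw [← ih, ← expec_const_mul, ← expec_const (s := s) hp1 (g i ^ 2), ← expec_add, ← expec_add]
      congr 1
      funext ω
      rw [Fin.sum_univ_succ]
      simp only [Fin.cons_zero, Fin.cons_succ]
      ring
    simp only [h, mul_add, Finset.sum_add_distrib, ← Finset.sum_mul, hp1]
    have h0 : ∀ c : ℝ, ∑ i, p i * (2 * g i * c) = 0 := by
      intro c
      rw [Finset.sum_congr rfl fun i _ => show p i * (2 * g i * c) = p i * g i * (2 * c) by ring,
        ← Finset.sum_mul, hg, zero_mul]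
    rw [h0]
    push_cast
    ring

/-- The variance bound for the importance-sampling estimator of `∑ i, q i`. -/
theorem expec_sq_sub_le {n s : ℕ} (hs : 0 < s) {p : Fin n → ℝ}
    (hp1 : ∑ i, p i = 1) (q : Fin n → ℝ) (hq : ∀ i, p i = 0 → q i = 0) :
    expec p (fun ω : Fin s → Fin n => (∑ j, q (ω j) / (s * p (ω j)) - ∑ i, q i) ^ 2) ≤
      (∑ i, q i ^ 2 / p i) / s := by
  have hs' : (0 : ℝ) < s := by exact_mod_cast hs
  set μ := ∑ i, q i with hμ
  have hpq : ∀ i, p i * (q i / p i) = q i := by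
    intro i
    by_cases h : p i = 0
    · simp [h, hq i h]
    · field_simp
  have hg : ∑ i, p i * (q i / p i - μ) = 0 := by
    simp only [mul_sub, hpq, Finset.sum_sub_distrib, ← Finset.sum_mul, hp1, ← hμ]
    ring
  have hvar := expec_sq_sum_of_centered (s := s) hg hp1
  have e : (fun ω : Fin s → Fin n => (∑ j, q (ω j) / (s * p (ω j)) - μ) ^ 2) =
      fun ω => (s ^ 2 : ℝ)⁻¹ * (∑ j, (q (ω j) / p (ω j) - μ)) ^ 2 := by
    funext ω
    have : ∑ j, q (ω j) / (s * p (ω j)) = (s : ℝ)⁻¹ * ∑ j, q (ω j) / p (ω j) := by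
      rw [Finset.mul_sum]
      refine Finset.sum_congr rfl fun j _ => ?_
      rw [div_mul_eq_div_div_swap, div_eq_inv_mul]
    rw [this, Finset.sum_sub_distrib]
    simp only [Finset.sum_const, Finset.card_univ, Fintype.card_fin, nsmul_eq_mul]
    field_simp
  rw [e, expec_const_mul, hvar]
  have hle : ∑ i, p i * (q i / p i - μ) ^ 2 ≤ ∑ i, q i ^ 2 / p i := by
    have h1 : ∀ i, p i * (q i / p i - μ) ^ 2 = q i ^ 2 / p i - 2 * μ * q i + μ ^ 2 * p i := by
      intro i
      by_cases h : p i = 0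
      · simp [h, hq i h]
      · field_simp; ring
    simp only [h1, Finset.sum_add_distrib, Finset.sum_sub_distrib, ← Finset.mul_sum, hp1, ← hμ]
    nlinarith [sq_nonneg μ]
  calc (s ^ 2 : ℝ)⁻¹ * (s * ∑ i, p i * (q i / p i - μ) ^ 2)
      = (∑ i, p i * (q i / p i - μ) ^ 2) / s := by field_simp
    _ ≤ _ := by gcongr

theorem expec_trace_exp_le {n s : ℕ} {m : Type*} [Fintype m] [DecidableEq m] [Nonempty m]
    {p : Fin n → ℝ} (hp : ∀ i, 0 ≤ p i) (hp1 : ∑ i, p i = 1) (v : Fin n → m → ℝ) {L : ℝ}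
    (hvL : ∀ i, v i ⬝ᵥ v i ≤ L) (hI : ∑ i, p i • vecMulVec (v i) (v i) = 1) (θ : ℝ)
    (hφ : 0 ≤ 1 + (Real.exp (θ * L) - 1) / L) :
    expec p (fun ω : Fin s → Fin n =>
        trace (NormedSpace.exp (θ • ∑ j, vecMulVec (v (ω j)) (v (ω j))))) ≤
      (1 + (Real.exp (θ * L) - 1) / L) ^ s * Fintype.card m := by
  set g := (Real.exp (θ * L) - 1) / L with hg
  induction s with
  | zero => simp [expec_zero]
  | succ s ih =>
    have hsymm : ∀ x : m → ℝ, (vecMulVec x x)ᵀ = vecMulVec x x := fun x => by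
      ext i j; simp [vecMulVec_apply, mul_comm]
    have hstep : ∀ (S : Matrix m m ℝ), Sᵀ = S → ∀ i,
        trace (NormedSpace.exp (θ • (vecMulVec (v i) (v i) + S))) ≤
          trace (NormedSpace.exp (θ • S)) +
            g * trace (NormedSpace.exp (θ • S) * vecMulVec (v i) (v i)) := by
      intro S hS i
      have hθS : (θ • S)ᵀ = θ • S := by rw [transpose_smul, hS]
      rw [smul_add, add_comm]
      by_cases hv : v i ⬝ᵥ v i = 0
      · rw [dotProduct_self_eq_zero.mp hv]
        simp
      refine (golden_thompson _ _ hθS (by rw [transpose_smul, hsymm])).trans ?_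
      rw [exp_smul_vecMulVec_self _ _ hv, mul_add, mul_one, trace_add, mul_smul_comm, trace_smul,
        smul_eq_mul]
      have hnn : 0 ≤ trace (NormedSpace.exp (θ • S) * vecMulVec (v i) (v i)) := by
        rw [mul_vecMulVec, trace_vecMulVec, dotProduct_comm]
        exact dotProduct_exp_mulVec_nonneg _ hθS _
      have hvpos : 0 < v i ⬝ᵥ v i := lt_of_le_of_ne
        (Finset.sum_nonneg fun _ _ => mul_self_nonneg _) (Ne.symm hv)
      have := exp_mul_sub_one_div_le (θ := θ) hvpos (hvL i)
      gcongr
    rw [expec_succ]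
    calc ∑ i, p i * expec p (fun ω : Fin s → Fin n => trace (NormedSpace.exp (θ • ∑ j,
            vecMulVec (v ((Fin.cons i ω : Fin (s + 1) → Fin n) j))
              (v ((Fin.cons i ω : Fin (s + 1) → Fin n) j)))))
        ≤ ∑ i, p i * expec p (fun ω : Fin s → Fin n =>
            trace (NormedSpace.exp (θ • ∑ j, vecMulVec (v (ω j)) (v (ω j)))) +
            g * trace (NormedSpace.exp (θ • ∑ j, vecMulVec (v (ω j)) (v (ω j))) *
              vecMulVec (v i) (v i))) := by
          refine Finset.sum_le_sum fun i _ => mul_le_mul_of_nonneg_left ?_ (hp i)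
          refine expec_mono hp fun ω => ?_
          simp only [Fin.sum_univ_succ, Fin.cons_zero, Fin.cons_succ]
          exact hstep _ (by rw [transpose_sum]; simp only [hsymm]) i
      _ = expec p (fun ω : Fin s → Fin n =>
            (1 + g) * trace (NormedSpace.exp (θ • ∑ j, vecMulVec (v (ω j)) (v (ω j))))) := by
          simp only [← expec_const_mul]
          rw [← expec_sum]
          congr 1
          funext ω
          have hM : ∀ M : Matrix m m ℝ,
              ∑ i, p i * trace (M * vecMulVec (v i) (v i)) = trace M := by
            intro M
            conv_rhs => rw [← mul_one M, ← hI, Finset.mul_sum, trace_sum]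
            simp [trace_smul]
          simp only [mul_add, Finset.sum_add_distrib, ← Finset.sum_mul, hp1, mul_left_comm (p _) g,
            ← Finset.mul_sum, hM]
          ring
      _ ≤ (1 + g) ^ (s + 1) * Fintype.card m := by
          rw [expec_const_mul, pow_succ', mul_assoc]
          gcongr

theorem mul_dotProduct_mulVec_le {m : Type*} [Fintype m] [DecidableEq m] (S : Matrix m m ℝ)
    (hS : Sᵀ = S) {θ b : ℝ} (h : Real.exp (-(θ * b)) * trace (NormedSpace.exp (θ • S)) < 1)
    (x : m → ℝ) : θ * (x ⬝ᵥ S *ᵥ x) ≤ θ * b * (x ⬝ᵥ x) := by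
  by_cases hx : x ⬝ᵥ x = 0
  · rw [dotProduct_self_eq_zero.mp hx]; simp
  have hpos : 0 < x ⬝ᵥ x := lt_of_le_of_ne
    (Finset.sum_nonneg fun _ _ => mul_self_nonneg _) (Ne.symm hx)
  set c := (Real.sqrt (x ⬝ᵥ x))⁻¹ with hc
  have hcc : c * c = (x ⬝ᵥ x)⁻¹ := by
    rw [hc, ← mul_inv, Real.mul_self_sqrt hpos.le]
  have hunit : (c • x) ⬝ᵥ (c • x) = 1 := by
    rw [smul_dotProduct, dotProduct_smul, smul_smul, hcc, smul_eq_mul, inv_mul_cancel₀ hx]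
  have h1 := exp_dotProduct_le_trace_exp (θ • S) (by rw [transpose_smul, hS]) (c • x) hunit
  have h2 : Real.exp (-(θ * b)) * Real.exp ((c • x) ⬝ᵥ (θ • S) *ᵥ (c • x)) < 1 :=
    (mul_le_mul_of_nonneg_left h1 (Real.exp_nonneg _)).trans_lt h
  rw [← Real.exp_add, Real.exp_lt_one_iff] at h2
  have e : (c • x) ⬝ᵥ (θ • S) *ᵥ (c • x) = (x ⬝ᵥ x)⁻¹ * (θ * (x ⬝ᵥ S *ᵥ x)) := by
    rw [mulVec_smul, smul_mulVec, smul_dotProduct, dotProduct_smul, dotProduct_smul, ← hcc]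
    simp only [smul_eq_mul]
    ring
  rw [e] at h2
  have h3 : (x ⬝ᵥ x)⁻¹ * (θ * (x ⬝ᵥ S *ᵥ x)) ≤ θ * b := by linarith
  rwa [inv_mul_le_iff₀ hpos, mul_comm (x ⬝ᵥ x)] at h3

/-- A matrix Chernoff bound for sums of independent rank-one matrices in isotropic position. -/
theorem expec_exp_mul_trace_exp_le {n s : ℕ} {m : Type*} [Fintype m] [DecidableEq m] [Nonempty m]
    {p : Fin n → ℝ} (hp : ∀ i, 0 ≤ p i) (hp1 : ∑ i, p i = 1) (v : Fin n → m → ℝ) {L : ℝ}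
    (hL : 1 ≤ L) (hvL : ∀ i, v i ⬝ᵥ v i ≤ L) (hI : ∑ i, p i • vecMulVec (v i) (v i) = 1)
    {η : ℝ} (hη : -1 < η) :
    expec p (fun ω : Fin s → Fin n => Real.exp (-(Real.log (1 + η) / L * (s * (1 + η)))) *
        trace (NormedSpace.exp ((Real.log (1 + η) / L) •
          ∑ j, vecMulVec (v (ω j)) (v (ω j))))) ≤
      Real.exp (-(s / L * ((1 + η) * Real.log (1 + η) - η))) * Fintype.card m := by
  have hL0 : 0 < L := by linarith
  have hg : (Real.exp (Real.log (1 + η) / L * L) - 1) / L = η / L := by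
    rw [div_mul_cancel₀ _ hL0.ne', Real.exp_log (by linarith), add_sub_cancel_left]
  have hφ : 0 ≤ 1 + η / L := by
    have : -1 ≤ η / L := by rw [le_div_iff₀ hL0]; linarith
    linarith
  have h := expec_trace_exp_le (s := s) hp hp1 v hvL hI (Real.log (1 + η) / L) (by rwa [hg])
  rw [hg] at h
  have hpow : (1 + η / L) ^ s ≤ Real.exp (s * (η / L)) := by
    rw [Real.exp_nat_mul]
    gcongr
    linarith [Real.add_one_le_exp (η / L)]
  rw [expec_const_mul]
  calc _ ≤ Real.exp (-(Real.log (1 + η) / L * (s * (1 + η)))) *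
        (Real.exp (s * (η / L)) * Fintype.card m) := by
          gcongr
          exact h.trans (by gcongr)
    _ = _ := by
      rw [← mul_assoc, ← Real.exp_add]
      congr 2
      field_simp
      ring
end Expectation

section Frobenius
variable {a b c : Type*} [Fintype a] [Fintype b] [Fintype c]

theorem trace_transpose_mul_eq_sum (P Q : Matrix a b ℝ) :
    trace (Pᵀ * Q) = ∑ i, ∑ j, P i j * Q i j := by
  simp only [trace, diag, mul_apply, transpose_apply]
  exact Finset.sum_comm

theorem trace_transpose_mul_self (P : Matrix a b ℝ) :
    trace (Pᵀ * P) = ∑ i, ∑ j, P i j ^ 2 := by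
  simp only [trace_transpose_mul_eq_sum, sq]

theorem trace_transpose_mul_self_nonneg (P : Matrix a b ℝ) : 0 ≤ trace (Pᵀ * P) := by
  rw [trace_transpose_mul_self]; positivity

theorem frobNorm_sq_s13 (P : Matrix a b ℝ) : frobNorm P ^ 2 = trace (Pᵀ * P) := by
  rw [frobNorm, Real.sq_sqrt (by positivity), trace_transpose_mul_self]

theorem sq_trace_transpose_mul_le (P Q : Matrix a b ℝ) :
    trace (Pᵀ * Q) ^ 2 ≤ trace (Pᵀ * P) * trace (Qᵀ * Q) := by
  simp only [trace_transpose_mul_self, trace_transpose_mul_eq_sum, ← Fintype.sum_prod_type']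
  exact Finset.sum_mul_sq_le_sq_mul_sq _ _ _

theorem one_sub_mul_transpose_mul_self [DecidableEq b] [DecidableEq c] (X : Matrix b c ℝ)
    (hX : Xᵀ * X = 1) : (1 - X * Xᵀ) * (1 - X * Xᵀ) = 1 - X * Xᵀ := by
  have h : X * Xᵀ * (X * Xᵀ) = X * Xᵀ := by
    rw [Matrix.mul_assoc, ← Matrix.mul_assoc Xᵀ, hX, Matrix.one_mul]
  simp only [sub_mul, mul_sub, h]
  simp

theorem trace_transpose_mul_self_mul_add [DecidableEq b] [DecidableEq c]
    (E : Matrix a b ℝ) (X : Matrix b c ℝ) (hX : Xᵀ * X = 1) :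
    trace ((E * X)ᵀ * (E * X)) + trace ((E * (1 - X * Xᵀ))ᵀ * (E * (1 - X * Xᵀ))) =
      trace (Eᵀ * E) := by
  have hP := one_sub_mul_transpose_mul_self X hX
  have hPt : (1 - X * Xᵀ)ᵀ = 1 - X * Xᵀ := by simp
  have h1 : trace ((E * X)ᵀ * (E * X)) = trace (Eᵀ * (E * (X * Xᵀ))) := by
    rw [transpose_mul, Matrix.mul_assoc, trace_mul_comm Xᵀ]
    simp only [Matrix.mul_assoc]
  have h2 : trace ((E * (1 - X * Xᵀ))ᵀ * (E * (1 - X * Xᵀ))) = trace (Eᵀ * (E * (1 - X * Xᵀ))) := by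
    rw [transpose_mul, hPt, Matrix.mul_assoc, trace_mul_comm, Matrix.mul_assoc, Matrix.mul_assoc,
      hP]
  rw [h1, h2, Matrix.mul_sub, Matrix.mul_one, Matrix.mul_sub, trace_sub]
  ring

theorem trace_transpose_mul_self_mul_le [DecidableEq b] [DecidableEq c]
    (E : Matrix a b ℝ) (X : Matrix b c ℝ) (hX : Xᵀ * X = 1) :
    trace ((E * X)ᵀ * (E * X)) ≤ trace (Eᵀ * E) := by
  linarith [trace_transpose_mul_self_mul_add E X hX,
    trace_transpose_mul_self_nonneg (E * (1 - X * Xᵀ))]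

theorem trace_one_sub_mul_transpose [DecidableEq b] [DecidableEq c] (X : Matrix b c ℝ)
    (hX : Xᵀ * X = 1) :
    trace ((1 - X * Xᵀ)ᵀ * (1 - X * Xᵀ)) =
      (Fintype.card b : ℝ) - Fintype.card c := by
  have hP := one_sub_mul_transpose_mul_self X hX
  have hPt : (1 - X * Xᵀ)ᵀ = 1 - X * Xᵀ := by simp
  rw [hPt, hP, trace_sub, trace_mul_comm, hX, trace_one, trace_one]

theorem abs_trace_quadratic_le (M : Matrix a a ℝ) (Y : Matrix a b ℝ) {ε : ℝ}
    (hM : ∀ x, |x ⬝ᵥ M *ᵥ x| ≤ ε * (x ⬝ᵥ x)) :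
    |trace (Yᵀ * (M * Y))| ≤ ε * trace (Yᵀ * Y) := by
  have e : ∀ Z : Matrix a b ℝ, trace (Yᵀ * Z) = ∑ j, (Y.col j) ⬝ᵥ (Z.col j) := fun Z => rfl
  rw [e, e, Finset.mul_sum]
  exact (Finset.abs_sum_le_sum_abs _ _).trans (Finset.sum_le_sum fun j _ => hM (Y.col j))

/-- A deterministic projection-cost bound: small errors on the head `B * C` and the tail `R`
of a matrix give a small relative error on every projection of complementary dimension. -/
theorem abs_trace_projection_cost_le {m : Type*} [Fintype m] [DecidableEq a] [DecidableEq b]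
    [DecidableEq c]
    (D : Matrix m m ℝ) (hD : Dᵀ = D) (B : Matrix m a ℝ) (C : Matrix a b ℝ) (R : Matrix m b ℝ)
    (hB : Bᵀ * B = 1) (hBR : Bᵀ * R = 0) (X : Matrix b c ℝ) (hX : Xᵀ * X = 1) {ε : ℝ} (hε : 0 ≤ ε)
    (hF : trace (Rᵀ * R) ≤ trace (((B * C + R) * X)ᵀ * ((B * C + R) * X)))
    (h1 : ∀ x, |x ⬝ᵥ (Bᵀ * D * B) *ᵥ x| ≤ ε * (x ⬝ᵥ x))
    (h2 : trace ((Bᵀ * D * R)ᵀ * (Bᵀ * D * R)) ≤ ε ^ 2 * trace (Rᵀ * R))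
    (h3 : |trace (Rᵀ * D * R)| ≤ ε * trace (Rᵀ * R))
    (h4 : trace ((Rᵀ * D * R)ᵀ * (Rᵀ * D * R)) * ((Fintype.card b : ℝ) - Fintype.card c) ≤
      (ε * trace (Rᵀ * R)) ^ 2) :
    |trace (((B * C + R) * X)ᵀ * D * ((B * C + R) * X))| ≤
      5 * ε * trace (((B * C + R) * X)ᵀ * ((B * C + R) * X)) := by
  set N := trace (((B * C + R) * X)ᵀ * ((B * C + R) * X)) with hN
  set F := trace (Rᵀ * R) with hFdef
  have hF0 : 0 ≤ F := trace_transpose_mul_self_nonneg R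
  have hN0 : 0 ≤ N := trace_transpose_mul_self_nonneg _
  have hRB : Rᵀ * B = 0 := by
    rw [← transpose_transpose (Rᵀ * B), transpose_mul, transpose_transpose, hBR, transpose_zero]
  have hNdec : N = trace ((C * X)ᵀ * (C * X)) + trace ((R * X)ᵀ * (R * X)) := by
    rw [hN, ← trace_add]
    congr 1
    have e1 : ∀ Z : Matrix a c ℝ, Bᵀ * (B * Z) = Z := fun Z => by
      rw [← Matrix.mul_assoc, hB, Matrix.one_mul]
    have e2 : ∀ Z : Matrix b c ℝ, Bᵀ * (R * Z) = 0 := fun Z => by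
      rw [← Matrix.mul_assoc, hBR, Matrix.zero_mul]
    have e3 : ∀ Z : Matrix a c ℝ, Rᵀ * (B * Z) = 0 := fun Z => by
      rw [← Matrix.mul_assoc, hRB, Matrix.zero_mul]
    simp only [Matrix.add_mul, transpose_add, transpose_mul, Matrix.mul_add, Matrix.mul_assoc, e1,
      e2, e3, Matrix.mul_zero,
      add_zero, zero_add]
  have hY : trace ((C * X)ᵀ * (C * X)) ≤ N := by
    linarith [trace_transpose_mul_self_nonneg (R * X)]
  have hY0 := trace_transpose_mul_self_nonneg (C * X)
  have hdec : trace (((B * C + R) * X)ᵀ * D * ((B * C + R) * X)) =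
      trace ((C * X)ᵀ * (Bᵀ * D * B * (C * X))) + 2 * trace ((C * X)ᵀ * (Bᵀ * D * R * X)) +
        (trace (Rᵀ * D * R) - trace ((Rᵀ * D * R)ᵀ * (1 - X * Xᵀ))) := by
    have e1 : trace ((C * X)ᵀ * (Bᵀ * D * R * X)) = trace (Xᵀ * (Rᵀ * (D * (B * (C * X))))) := by
      rw [← trace_transpose]
      simp only [transpose_mul, transpose_transpose, hD, Matrix.mul_assoc]
    have e2 : trace (Rᵀ * D * R) - trace ((Rᵀ * D * R)ᵀ * (1 - X * Xᵀ)) =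
        trace (Xᵀ * (Rᵀ * (D * (R * X)))) := by
      have : (Rᵀ * D * R)ᵀ = Rᵀ * D * R := by
        simp only [transpose_mul, transpose_transpose, hD, Matrix.mul_assoc]
      rw [this, Matrix.mul_sub, Matrix.mul_one, trace_sub, sub_sub_cancel, ← Matrix.mul_assoc,
        trace_mul_comm]
      simp only [Matrix.mul_assoc]
    rw [e2, two_mul]
    nth_rewrite 2 [e1]
    simp only [← trace_add]
    congr 1
    simp only [Matrix.add_mul, transpose_add, transpose_mul, Matrix.mul_add, Matrix.mul_assoc]
    abel
  have t1 : |trace ((C * X)ᵀ * (Bᵀ * D * B * (C * X)))| ≤ ε * N :=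
    (abs_trace_quadratic_le _ _ h1).trans (by gcongr)
  have t2 : |trace ((C * X)ᵀ * (Bᵀ * D * R * X))| ≤ ε * N := by
    refine abs_le_of_sq_le_sq ?_ (by positivity)
    calc _ ≤ _ := sq_trace_transpose_mul_le _ _
      _ ≤ N * (ε ^ 2 * N) := by
        refine mul_le_mul hY ?_ (trace_transpose_mul_self_nonneg _) hN0
        exact (trace_transpose_mul_self_mul_le _ _ hX).trans (h2.trans (by gcongr))
      _ = _ := by ring
  have t3 : |trace (Rᵀ * D * R)| ≤ ε * N := h3.trans (by gcongr)
  have t4 : |trace ((Rᵀ * D * R)ᵀ * (1 - X * Xᵀ))| ≤ ε * N := by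
    refine abs_le_of_sq_le_sq ?_ (by positivity)
    calc _ ≤ _ := sq_trace_transpose_mul_le _ _
      _ ≤ (ε * F) ^ 2 := by rw [trace_one_sub_mul_transpose X hX]; exact h4
      _ ≤ _ := by gcongr
  rw [hdec]
  rw [abs_le] at *
  constructor <;> linarith [t1.1, t1.2, t2.1, t2.2, t3.1, t3.2, t4.1, t4.2]
end Frobenius

section LowRank

theorem sum_tail_sq_le {r k : ℕ} (hkr : k < r) {σ t : Fin r → ℝ}
    (hσdec : ∀ i j : Fin r, i ≤ j → σ j ≤ σ i) (hσpos : ∀ i, 0 < σ i) (ht0 : ∀ i, 0 ≤ t i)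
    (ht1 : ∀ i, t i ≤ 1) (ht : (r : ℝ) - k ≤ ∑ i, t i) :
    ∑ i : Fin r, (if (i : ℕ) < k then 0 else σ i) ^ 2 ≤ ∑ i, σ i ^ 2 * t i := by
  set c := σ ⟨k, hkr⟩ ^ 2
  have hcard : ∑ i : Fin r, (if (i : ℕ) < k then (0 : ℝ) else 1) = r - k := by
    rw [Fin.sum_univ_eq_sum_range (fun i => if i < k then (0 : ℝ) else 1) r]
    obtain ⟨m, rfl⟩ := Nat.exists_eq_add_of_lt hkr
    rw [add_assoc, Finset.sum_range_add, Finset.sum_eq_zero fun i hi => by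
      simp [Finset.mem_range.mp hi]]
    simp
  have h : ∀ i : Fin r, c * (t i - if (i : ℕ) < k then (0 : ℝ) else 1) ≤
      σ i ^ 2 * t i - (if (i : ℕ) < k then 0 else σ i) ^ 2 := by
    intro i
    split_ifs with hi
    · have : c ≤ σ i ^ 2 := pow_le_pow_left₀ (hσpos _).le (hσdec _ _ (Fin.mk_le_mk.mpr hi.le)) 2
      nlinarith [ht0 i]
    · have : σ i ^ 2 ≤ c :=
        pow_le_pow_left₀ (hσpos _).le (hσdec _ _ (Fin.mk_le_mk.mpr (not_lt.mp hi))) 2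
      nlinarith [ht1 i]
  have hs := Finset.sum_le_sum fun i (_ : i ∈ Finset.univ) => h i
  rw [← Finset.mul_sum, Finset.sum_sub_distrib, Finset.sum_sub_distrib, hcard] at hs
  have : 0 ≤ c * (∑ i, t i - ((r : ℝ) - k)) := mul_nonneg (sq_nonneg _) (by linarith)
  linarith

theorem trace_transpose_mul_self_svd {a r b : Type*} [Fintype a] [Fintype r] [Fintype b]
    [DecidableEq r] (U : Matrix a r ℝ) (hU : Uᵀ * U = 1) (τ : r → ℝ) (M : Matrix r b ℝ) :
    trace ((U * diagonal τ * M)ᵀ * (U * diagonal τ * M)) = ∑ i, τ i ^ 2 * ∑ c, M i c ^ 2 := by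
  have : (U * diagonal τ * M)ᵀ * (U * diagonal τ * M) = (diagonal τ * M)ᵀ * (diagonal τ * M) := by
    rw [Matrix.mul_assoc, transpose_mul U, Matrix.mul_assoc, ← Matrix.mul_assoc Uᵀ, hU,
      Matrix.one_mul]
  rw [this, trace_transpose_mul_self]
  simp only [diagonal_mul, mul_pow, Finset.mul_sum]

/-- The Eckart–Young inequality in the form used for projections onto `d - k` dimensions. -/
theorem trace_tail_le {n d r k l : ℕ} (hkr : k < r) (U : Matrix (Fin n) (Fin r) ℝ)
    (V : Matrix (Fin d) (Fin r) ℝ) {σ : Fin r → ℝ} (hU : Uᵀ * U = 1) (hV : Vᵀ * V = 1)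
    (hσdec : ∀ i j : Fin r, i ≤ j → σ j ≤ σ i) (hσpos : ∀ i, 0 < σ i)
    (X : Matrix (Fin d) (Fin l) ℝ) (hX : Xᵀ * X = 1) (hdl : (d : ℝ) - l = k) :
    ∑ i : Fin r, (if (i : ℕ) < k then 0 else σ i) ^ 2 ≤
      trace ((U * diagonal σ * Vᵀ * X)ᵀ * (U * diagonal σ * Vᵀ * X)) := by
  rw [Matrix.mul_assoc, trace_transpose_mul_self_svd U hU]
  refine sum_tail_sq_le hkr hσdec hσpos (fun i => by positivity) (fun i => ?_) ?_
  · have h := trace_transpose_mul_self_mul_le (Matrix.of fun (_ : Unit) c => V c i) X hX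
    have hVi := congrFun (congrFun hV i) i
    simp only [mul_apply, transpose_apply, one_apply_eq] at hVi
    simp only [trace_transpose_mul_self, mul_apply, of_apply, Finset.univ_unique,
      Finset.sum_singleton, sq, hVi] at h
    simpa only [mul_apply, transpose_apply, sq] using h
  · rw [← trace_transpose_mul_self]
    have h1 := trace_transpose_mul_self_mul_add Vᵀ X hX
    have h2 := trace_transpose_mul_self_mul_le (1 - X * Xᵀ)ᵀ V hV
    have e : trace ((Vᵀ * (1 - X * Xᵀ))ᵀ * (Vᵀ * (1 - X * Xᵀ))) =
        trace (((1 - X * Xᵀ)ᵀ * V)ᵀ * ((1 - X * Xᵀ)ᵀ * V)) := by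
      rw [trace_mul_comm, ← trace_transpose]
      simp only [transpose_mul, transpose_transpose, Matrix.mul_assoc]
    have e2 : trace ((1 - X * Xᵀ)ᵀᵀ * (1 - X * Xᵀ)ᵀ) = (k : ℝ) := by
      rw [transpose_transpose, trace_mul_comm, trace_one_sub_mul_transpose X hX]
      simpa using hdl
    have e3 : trace (Vᵀᵀ * Vᵀ) = (r : ℝ) := by
      rw [transpose_transpose, trace_mul_comm, hV, trace_one, Fintype.card_fin]
    linarith

end LowRank

section Sampling

theorem eq_zero_of_sum_sq_nonpos {a : Type*} [Fintype a] {f : a → ℝ} (h : ∑ x, f x ^ 2 ≤ 0)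
    (x : a) :
    f x = 0 := by
  have hx := (Finset.single_le_sum (f := fun x => f x ^ 2) (fun _ _ => sq_nonneg _)
    (Finset.mem_univ x)).trans h
  exact pow_eq_zero_iff two_ne_zero |>.mp (le_antisymm hx (sq_nonneg _))

/-- The deviation `WᵀW - 1` of the Gram matrix of a sampling matrix from the identity. -/
noncomputable def samplingError {n s : ℕ} (p : Fin n → ℝ) (ω : Fin s → Fin n) :
    Matrix (Fin n) (Fin n) ℝ :=
  (samplingMatrix p s ω)ᵀ * samplingMatrix p s ω - 1

theorem samplingError_transpose {n s : ℕ} (p : Fin n → ℝ) (ω : Fin s → Fin n) :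
    (samplingError p ω)ᵀ = samplingError p ω := by
  simp [samplingError]

theorem frobNorm_samplingMatrix_mul_sq_sub {n s : ℕ} {a : Type*} [Fintype a] (p : Fin n → ℝ)
    (ω : Fin s → Fin n) (M : Matrix (Fin n) a ℝ) :
    frobNorm (samplingMatrix p s ω * M) ^ 2 - frobNorm M ^ 2 =
      trace (Mᵀ * samplingError p ω * M) := by
  rw [frobNorm_sq_s13, frobNorm_sq_s13, ← trace_sub]
  simp only [samplingError, Matrix.mul_sub, Matrix.sub_mul, Matrix.mul_one, transpose_mul,
    Matrix.mul_assoc]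

theorem samplingMatrix_mul_apply {n s : ℕ} {a : Type*} (p : Fin n → ℝ) (ω : Fin s → Fin n)
    (M : Matrix (Fin n) a ℝ) (j : Fin s) (z : a) :
    (samplingMatrix p s ω * M) j z = 1 / Real.sqrt (s * p (ω j)) * M (ω j) z := by
  simp [mul_apply, samplingMatrix, Finset.sum_ite_eq']

theorem transpose_mul_samplingError_mul_apply {n s : ℕ} {a b : Type*}
    {p : Fin n → ℝ} (hp : ∀ i, 0 ≤ p i) (ω : Fin s → Fin n)
    (P : Matrix (Fin n) a ℝ) (Q : Matrix (Fin n) b ℝ) (x : a) (y : b) :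
    (Pᵀ * samplingError p ω * Q : Matrix a b ℝ) x y =
      ∑ j, P (ω j) x * Q (ω j) y / (s * p (ω j)) - ∑ i, P i x * Q i y := by
  have e : Pᵀ * samplingError p ω * Q =
      (samplingMatrix p s ω * P)ᵀ * (samplingMatrix p s ω * Q) - Pᵀ * Q := by
    simp only [samplingError, Matrix.mul_sub, Matrix.sub_mul, Matrix.mul_one, transpose_mul,
      Matrix.mul_assoc]
  rw [e, Matrix.sub_apply, mul_apply, mul_apply]
  simp only [transpose_apply]
  congr 1
  refine Finset.sum_congr rfl fun j _ => ?_
  have hj : 0 ≤ s * p (ω j) := mul_nonneg s.cast_nonneg (hp _)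
  rw [samplingMatrix_mul_apply, samplingMatrix_mul_apply, mul_mul_mul_comm, ← mul_div_mul_comm,
    Real.mul_self_sqrt hj]
  ring

theorem expec_trace_transpose_mul_samplingError_mul_le {n s : ℕ} (hs : 0 < s) {a b : Type*}
    [Fintype a] [Fintype b] {p : Fin n → ℝ} (hp : ∀ i, 0 ≤ p i) (hp1 : ∑ i, p i = 1)
    (P : Matrix (Fin n) a ℝ) (Q : Matrix (Fin n) b ℝ) {L : ℝ}
    (hL : ∀ i, ∑ x, P i x ^ 2 ≤ L * p i) (hL0 : 0 ≤ L) :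
    expec p (fun ω : Fin s → Fin n =>
        trace ((Pᵀ * samplingError p ω * Q)ᵀ * (Pᵀ * samplingError p ω * Q))) ≤
      L * trace (Qᵀ * Q) / s := by
  have hzero : ∀ i, p i = 0 → ∀ x, P i x = 0 := fun i hi =>
    eq_zero_of_sum_sq_nonpos (by simpa [hi] using hL i)
  simp only [trace_transpose_mul_self, transpose_mul_samplingError_mul_apply hp, expec_sum]
  calc _ ≤ ∑ x, ∑ y, (∑ i, (P i x * Q i y) ^ 2 / p i) / s :=
        Finset.sum_le_sum fun x _ => Finset.sum_le_sum fun y _ =>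
          expec_sq_sub_le hs hp1 (fun i => P i x * Q i y) fun i hi => by simp [hzero i hi x]
    _ = (∑ i, (∑ x, P i x ^ 2) / p i * ∑ y, Q i y ^ 2) / s := by
        simp only [← Finset.sum_div]
        congr 1
        simp only [Finset.sum_comm (s := (Finset.univ : Finset b)) (t := Finset.univ (α := Fin n))]
        rw [Finset.sum_comm]
        refine Finset.sum_congr rfl fun i _ => ?_
        rw [Finset.sum_div, Finset.sum_mul_sum]
        exact Finset.sum_congr rfl fun x _ => Finset.sum_congr rfl fun y _ => by ring
    _ ≤ _ := by
        rw [Finset.mul_sum]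
        gcongr with i _
        rcases (hp i).eq_or_lt with hi | hi
        · rw [← hi, div_zero]; exact hL0
        · rw [div_le_iff₀ hi]; exact hL i

theorem expec_sq_trace_samplingError_le {n s : ℕ} (hs : 0 < s) {a : Type*}
    [Fintype a] {p : Fin n → ℝ} (hp : ∀ i, 0 ≤ p i) (hp1 : ∑ i, p i = 1)
    (P : Matrix (Fin n) a ℝ) {L : ℝ} (hL : ∀ i, ∑ x, P i x ^ 2 ≤ L * p i) (hL0 : 0 ≤ L) :
    expec p (fun ω : Fin s → Fin n => trace (Pᵀ * samplingError p ω * P) ^ 2) ≤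
      L * trace (Pᵀ * P) / s := by
  have e : ∀ ω : Fin s → Fin n, trace (Pᵀ * samplingError p ω * P) =
      ∑ j, (∑ x, P (ω j) x ^ 2) / (s * p (ω j)) - ∑ i, ∑ x, P i x ^ 2 := by
    intro ω
    simp only [trace, diag, transpose_mul_samplingError_mul_apply hp, Finset.sum_sub_distrib,
      ← sq, Finset.sum_div]
    congr 1 <;> exact Finset.sum_comm
  simp only [e]
  refine (expec_sq_sub_le hs hp1 (fun i => ∑ x, P i x ^ 2) fun i hi => ?_).trans ?_
  · exact le_antisymm (by simpa [hi] using hL i) (by positivity)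
  · rw [trace_transpose_mul_self, Finset.mul_sum]
    gcongr with i _
    rcases (hp i).eq_or_lt with hi | hi
    · rw [← hi, div_zero]; positivity
    · rw [div_le_iff₀ hi, sq, mul_right_comm]
      exact mul_le_mul_of_nonneg_right (hL i) (by positivity)

theorem trace_exp_nonneg {m : Type*} [Fintype m] [DecidableEq m] (S : Matrix m m ℝ) (hS : Sᵀ = S) :
    0 ≤ trace (NormedSpace.exp S) := by
  refine Finset.sum_nonneg fun i _ => ?_
  simpa using dotProduct_exp_mulVec_nonneg S hS (Pi.single i 1)

theorem exists_expec_le_of_isotropic {n s : ℕ} (hs : 0 < s) {m : Type*} [Fintype m] [DecidableEq m]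
    [Nonempty m] {p : Fin n → ℝ} (hp : ∀ i, 0 ≤ p i) (hp1 : ∑ i, p i = 1)
    (B : Matrix (Fin n) m ℝ) (hB : Bᵀ * B = 1) {L : ℝ} (hL : 1 ≤ L)
    (hBL : ∀ i, ∑ x, B i x ^ 2 ≤ L * p i) {ε : ℝ} (hε0 : 0 < ε) (hε1 : ε < 1) :
    ∃ g : (Fin s → Fin n) → ℝ, (∀ ω, 0 ≤ g ω) ∧
      expec p g ≤ 2 * (Real.exp (-(s / L * (ε ^ 2 / (2 * (1 + ε / 3))))) * Fintype.card m) ∧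
      ∀ ω, g ω < 1 → ∀ x, |x ⬝ᵥ (Bᵀ * samplingError p ω * B) *ᵥ x| ≤ ε * (x ⬝ᵥ x) := by
  have hs' : (0 : ℝ) < s := by exact_mod_cast hs
  have hL0 : 0 < L := by linarith
  have hzero : ∀ i, p i = 0 → ∀ x, B i x = 0 := fun i hi =>
    eq_zero_of_sum_sq_nonpos (by simpa [hi] using hBL i)
  set v : Fin n → m → ℝ := fun i x => (Real.sqrt (p i))⁻¹ * B i x with hv
  have hvv : ∀ i x y, v i x * v i y = B i x * B i y / p i := by
    intro i x y
    rw [hv]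
    simp only
    rw [mul_mul_mul_comm, ← mul_inv, Real.mul_self_sqrt (hp i)]
    ring
  have hvL : ∀ i, v i ⬝ᵥ v i ≤ L := by
    intro i
    simp only [dotProduct, hvv, ← Finset.sum_div, ← sq]
    rcases (hp i).eq_or_lt with hi | hi
    · rw [← hi, div_zero]; exact hL0.le
    · rw [div_le_iff₀ hi]; exact hBL i
  have hI : ∑ i, p i • vecMulVec (v i) (v i) = 1 := by
    rw [← hB]
    ext x y
    simp only [Matrix.sum_apply, Matrix.smul_apply, vecMulVec_apply, hvv, mul_apply,
      transpose_apply, smul_eq_mul]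
    refine Finset.sum_congr rfl fun i _ => ?_
    by_cases hi : p i = 0
    · simp [hi, hzero i hi x]
    · field_simp
  set S : (Fin s → Fin n) → Matrix m m ℝ := fun ω => ∑ j, vecMulVec (v (ω j)) (v (ω j)) with hSdef
  have hS : ∀ ω, (S ω)ᵀ = S ω := by
    intro ω
    simp only [hSdef, transpose_sum, transpose_vecMulVec]
  have hSB : ∀ ω, Bᵀ * samplingError p ω * B = (s : ℝ)⁻¹ • S ω - 1 := by
    intro ω
    rw [← hB]
    ext x y
    rw [transpose_mul_samplingError_mul_apply hp]
    simp only [hSdef, Matrix.sub_apply, Matrix.sum_apply, Matrix.smul_apply, vecMulVec_apply, hvv,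
      mul_apply,
      transpose_apply, smul_eq_mul, Finset.mul_sum]
    congr 1
    exact Finset.sum_congr rfl fun j _ => by ring
  set G : ℝ → (Fin s → Fin n) → ℝ := fun η ω =>
    Real.exp (-(Real.log (1 + η) / L * (s * (1 + η)))) *
      trace (NormedSpace.exp ((Real.log (1 + η) / L) • S ω)) with hG
  have hG0 : ∀ η ω, 0 ≤ G η ω := fun η ω =>
    mul_nonneg (Real.exp_nonneg _) (trace_exp_nonneg _ (by rw [transpose_smul, hS]))
  have hGe : ∀ η, -1 < η → ε ^ 2 / (2 * (1 + ε / 3)) ≤ (1 + η) * Real.log (1 + η) - η →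
      expec p (G η) ≤ Real.exp (-(s / L * (ε ^ 2 / (2 * (1 + ε / 3))))) * Fintype.card m := by
    intro η hη h
    refine (expec_exp_mul_trace_exp_le hp hp1 v hL hvL hI hη).trans ?_
    gcongr
  refine ⟨fun ω => G ε ω + G (-ε) ω, fun ω => add_nonneg (hG0 _ _) (hG0 _ _), ?_, ?_⟩
  · rw [expec_add, two_mul]
    refine add_le_add (hGe ε (by linarith) (sq_div_le_one_add_mul_log hε0.le))
      (hGe (-ε) (by linarith) ?_)
    simpa [sub_eq_add_neg] using sq_div_le_one_sub_mul_log hε0.le hε1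
  · intro ω hω x
    have hup := mul_dotProduct_mulVec_le (S ω) (hS ω)
      (show G ε ω < 1 by linarith [hG0 (-ε) ω]) x
    have hlo := mul_dotProduct_mulVec_le (S ω) (hS ω)
      (show G (-ε) ω < 1 by linarith [hG0 ε ω]) x
    have hθ : 0 < Real.log (1 + ε) / L := div_pos (Real.log_pos (by linarith)) hL0
    have hθ' : Real.log (1 + -ε) / L < 0 :=
      div_neg_of_neg_of_pos (Real.log_neg (by linarith) (by linarith)) hL0
    rw [mul_assoc, mul_le_mul_iff_right₀ hθ] at hup
    rw [mul_assoc, mul_le_mul_left_of_neg hθ'] at hlo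
    have e : x ⬝ᵥ (Bᵀ * samplingError p ω * B) *ᵥ x = (s : ℝ)⁻¹ * (x ⬝ᵥ S ω *ᵥ x) - x ⬝ᵥ x := by
      rw [hSB, sub_mulVec, smul_mulVec, one_mulVec, dotProduct_sub, dotProduct_smul, smul_eq_mul]
    rw [e, abs_le]
    have hup' := mul_le_mul_of_nonneg_left hup (inv_nonneg.mpr hs'.le)
    have hlo' := mul_le_mul_of_nonneg_left hlo (inv_nonneg.mpr hs'.le)
    rw [mul_assoc, inv_mul_cancel_left₀ hs'.ne'] at hup' hlo'
    constructor <;> linarith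

theorem probOf_mono {n s : ℕ} {p : Fin n → ℝ} (hp : ∀ i, 0 ≤ p i) {E E' : (Fin s → Fin n) → Prop}
    (h : ∀ ω, E ω → E' ω) : probOf p E ≤ probOf p E' := by
  classical
  refine Finset.sum_le_sum fun ω _ => ?_
  by_cases hE : E ω
  · simp [hE, h ω hE]
  · rw [if_neg hE]
    split_ifs
    · exact Finset.prod_nonneg fun _ _ => hp _
    · exact le_rfl

theorem two_mul_exp_neg_mul_le {s k ε δ : ℝ} (hk : 0 < k) (hε : 0 < ε) (hδ : 0 < δ)
    (hs : (1 + ε / 3) * (4 * k * Real.log (16 * (1 + k) / δ)) / ε ^ 2 ≤ s) :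
    2 * (Real.exp (-(s / (2 * k) * (ε ^ 2 / (2 * (1 + ε / 3))))) * k) ≤ δ / 4 := by
  have hl : Real.log (16 * (1 + k) / δ) ≤ s / (2 * k) * (ε ^ 2 / (2 * (1 + ε / 3))) := by
    rw [div_le_iff₀ (by positivity)] at hs
    rw [div_mul_div_comm, le_div_iff₀ (by positivity)]
    linarith
  have he : Real.exp (-(s / (2 * k) * (ε ^ 2 / (2 * (1 + ε / 3))))) ≤ δ / (16 * (1 + k)) := by
    calc _ ≤ Real.exp (-Real.log (16 * (1 + k) / δ)) := by gcongr
      _ = _ := by rw [Real.exp_neg, Real.exp_log (by positivity), inv_div]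
  calc _ ≤ 2 * (δ / (16 * (1 + k)) * k) := by gcongr
    _ ≤ δ / 4 := by
      rw [div_mul_eq_mul_div, mul_div_assoc', div_le_div_iff₀ (by positivity) (by norm_num)]
      nlinarith [mul_pos hδ hk]

theorem one_sub_le_probOf_samplingError {n d k s : ℕ} (hs : 0 < s) (hk : 1 ≤ k)
    {p : Fin n → ℝ} (hp : ∀ i, 0 ≤ p i) (hp1 : ∑ i, p i = 1)
    (B : Matrix (Fin n) (Fin k) ℝ) (R : Matrix (Fin n) (Fin d) ℝ) (hB : Bᵀ * B = 1)
    (hF : 0 < trace (Rᵀ * R)) (hBp : ∀ i, ∑ x, B i x ^ 2 ≤ 2 * k * p i)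
    (hRp : ∀ i, ∑ x, R i x ^ 2 ≤ 2 * trace (Rᵀ * R) * p i) {ε δ : ℝ} (hε0 : 0 < ε) (hε1 : ε < 1)
    (hδ : 0 < δ) (hs1 : (1 + ε / 3) * (4 * k * Real.log (16 * (1 + k) / δ)) / ε ^ 2 ≤ s)
    (hs2 : 8 * k / (δ * ε ^ 2) ≤ s) :
    1 - δ ≤ probOf p fun ω : Fin s → Fin n =>
      (∀ x, |x ⬝ᵥ (Bᵀ * samplingError p ω * B) *ᵥ x| ≤ ε * (x ⬝ᵥ x)) ∧
      trace ((Bᵀ * samplingError p ω * R)ᵀ * (Bᵀ * samplingError p ω * R)) ≤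
        ε ^ 2 * trace (Rᵀ * R) ∧
      |trace (Rᵀ * samplingError p ω * R)| ≤ ε * trace (Rᵀ * R) ∧
      trace ((Rᵀ * samplingError p ω * R)ᵀ * (Rᵀ * samplingError p ω * R)) * k ≤
        (ε * trace (Rᵀ * R)) ^ 2 := by
  set F := trace (Rᵀ * R) with hFdef
  have hs' : (0 : ℝ) < s := by exact_mod_cast hs
  have hk' : (1 : ℝ) ≤ k := by exact_mod_cast hk
  have hk0 : (0 : ℝ) < k := by linarith
  have : Nonempty (Fin k) := ⟨⟨0, hk⟩⟩
  obtain ⟨g, hg0, hge, hg⟩ := exists_expec_le_of_isotropic hs hp hp1 B hB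
    (show (1 : ℝ) ≤ 2 * k by linarith) hBp hε0 hε1
  have hge' : expec p g ≤ δ / 4 := by
    refine hge.trans ?_
    rw [Fintype.card_fin]
    exact two_mul_exp_neg_mul_le hk0 hε0 hδ hs1
  set T := fun ω : Fin s → Fin n =>
    trace ((Bᵀ * samplingError p ω * R)ᵀ * (Bᵀ * samplingError p ω * R)) with hT
  set Q := fun ω : Fin s → Fin n => trace (Rᵀ * samplingError p ω * R) with hQ
  set Z := fun ω : Fin s → Fin n =>
    trace ((Rᵀ * samplingError p ω * R)ᵀ * (Rᵀ * samplingError p ω * R)) with hZ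
  have hTe : expec p T ≤ 2 * k * F / s :=
    expec_trace_transpose_mul_samplingError_mul_le hs hp hp1 B R hBp (by positivity)
  have hQe : expec p (fun ω => Q ω ^ 2) ≤ 2 * F * F / s :=
    expec_sq_trace_samplingError_le hs hp hp1 R hRp (by positivity)
  have hZe : expec p Z ≤ 2 * F * F / s :=
    expec_trace_transpose_mul_samplingError_mul_le hs hp hp1 R R hRp (by positivity)
  have hT0 : ∀ ω, 0 ≤ T ω := fun ω => trace_transpose_mul_self_nonneg _
  have hZ0 : ∀ ω, 0 ≤ Z ω := fun ω => trace_transpose_mul_self_nonneg _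
  have hks : 8 * k ≤ s * (δ * ε ^ 2) := (div_le_iff₀ (by positivity)).mp hs2
  set f : (Fin s → Fin n) → ℝ := fun ω => g ω + ((ε ^ 2 * F)⁻¹ * T ω +
    (((ε * F) ^ 2)⁻¹ * Q ω ^ 2 + (k / (ε * F) ^ 2) * Z ω)) with hf
  have hfe : expec p f ≤ δ := by
    rw [hf, expec_add, expec_add, expec_add, expec_const_mul, expec_const_mul, expec_const_mul]
    have b1 : (ε ^ 2 * F)⁻¹ * expec p T ≤ δ / 4 := by
      calc _ ≤ (ε ^ 2 * F)⁻¹ * (2 * k * F / s) := by gcongr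
        _ = 2 * k / (s * ε ^ 2) := by field_simp
        _ ≤ _ := by rw [div_le_div_iff₀ (by positivity) (by norm_num)]; linarith
    have b2 : ((ε * F) ^ 2)⁻¹ * expec p (fun ω => Q ω ^ 2) ≤ δ / 4 := by
      calc _ ≤ ((ε * F) ^ 2)⁻¹ * (2 * F * F / s) := by gcongr
        _ = 2 / (s * ε ^ 2) := by field_simp
        _ ≤ _ := by rw [div_le_div_iff₀ (by positivity) (by norm_num)]; linarith
    have b3 : (k / (ε * F) ^ 2) * expec p Z ≤ δ / 4 := by
      calc _ ≤ (k / (ε * F) ^ 2) * (2 * F * F / s) := by gcongr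
        _ = 2 * k / (s * ε ^ 2) := by field_simp
        _ ≤ _ := by rw [div_le_div_iff₀ (by positivity) (by norm_num)]; linarith
    linarith
  have hterms : ∀ ω, 0 ≤ (ε ^ 2 * F)⁻¹ * T ω ∧ 0 ≤ ((ε * F) ^ 2)⁻¹ * Q ω ^ 2 ∧
      0 ≤ (k / (ε * F) ^ 2) * Z ω := fun ω =>
    ⟨mul_nonneg (by positivity) (hT0 ω), by positivity, mul_nonneg (by positivity) (hZ0 ω)⟩
  refine (sub_le_sub_left hfe 1).trans (one_sub_le_probOf hp hp1 (fun ω => ?_) fun ω hω => ?_)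
  · have := hterms ω
    have := hg0 ω
    simp only [hf]
    linarith
  · obtain ⟨n1, n2, n3⟩ := hterms ω
    have n0 := hg0 ω
    simp only [hf] at hω
    refine ⟨hg ω (by linarith), ?_, ?_, ?_⟩
    · have h : (ε ^ 2 * F)⁻¹ * T ω < 1 := by linarith
      rw [inv_mul_lt_iff₀ (by positivity), mul_one] at h
      exact h.le
    · have h : ((ε * F) ^ 2)⁻¹ * Q ω ^ 2 < 1 := by linarith
      rw [inv_mul_lt_iff₀ (by positivity), mul_one] at h
      exact abs_le_of_sq_le_sq h.le (by positivity)
    · have h : (k / (ε * F) ^ 2) * Z ω < 1 := by linarith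
      rw [div_mul_eq_mul_div, div_lt_one (by positivity), mul_comm] at h
      exact h.le

end Sampling

section Truncation

theorem firstCols_transpose_mul_self {n r k : ℕ} (hkr : k ≤ r) (U : Matrix (Fin n) (Fin r) ℝ)
    (hU : Uᵀ * U = 1) : (firstCols U k hkr)ᵀ * firstCols U k hkr = 1 := by
  ext x y
  have h := congrFun (congrFun hU (Fin.castLE hkr x)) (Fin.castLE hkr y)
  rw [mul_apply] at h ⊢
  refine h.trans ?_
  simp [one_apply, Fin.ext_iff]

theorem sub_mul_truncDiag {n d r : ℕ} (k : ℕ) (U : Matrix (Fin n) (Fin r) ℝ)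
    (V : Matrix (Fin d) (Fin r) ℝ) (σ : Fin r → ℝ) :
    U * diagonal σ * Vᵀ - U * truncDiag σ k * Vᵀ =
      U * diagonal (fun i : Fin r => if (i : ℕ) < k then 0 else σ i) * Vᵀ := by
  rw [← Matrix.sub_mul, ← Matrix.mul_sub, truncDiag, diagonal_sub]
  congr 3
  ext i
  split_ifs <;> simp

theorem firstCols_transpose_mul_tail {n d r k : ℕ} (hkr : k ≤ r) (U : Matrix (Fin n) (Fin r) ℝ)
    (V : Matrix (Fin d) (Fin r) ℝ) (σ : Fin r → ℝ) (hU : Uᵀ * U = 1) :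
    (firstCols U k hkr)ᵀ *
      (U * diagonal (fun i : Fin r => if (i : ℕ) < k then 0 else σ i) * Vᵀ) = 0 := by
  ext x y
  have h : ((firstCols U k hkr)ᵀ * U) x = (1 : Matrix (Fin r) (Fin r) ℝ) (Fin.castLE hkr x) :=
    congrFun hU (Fin.castLE hkr x)
  rw [Matrix.mul_assoc, ← Matrix.mul_assoc, mul_apply, h]
  simp only [one_apply, ite_mul, one_mul, zero_mul, Finset.sum_ite_eq, Finset.mem_univ, if_true]
  simp [diagonal_mul]

theorem firstCols_mul_eq {n d r k : ℕ} (hkr : k ≤ r) (U : Matrix (Fin n) (Fin r) ℝ)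
    (V : Matrix (Fin d) (Fin r) ℝ) (σ : Fin r → ℝ) :
    firstCols U k hkr * (Matrix.of fun x y => σ (Fin.castLE hkr x) * V y (Fin.castLE hkr x)) =
      U * truncDiag σ k * Vᵀ := by
  ext i j
  rw [truncDiag, Matrix.mul_assoc, mul_apply, mul_apply]
  simp only [firstCols, of_apply, diagonal_mul, transpose_apply, ite_mul, zero_mul, mul_ite,
    mul_zero]
  obtain ⟨l, rfl⟩ := Nat.exists_eq_add_of_le hkr
  rw [Fin.sum_univ_add]
  simp [Fin.castAdd, Fin.natAdd]

end Truncation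

/-- leverage-score sampling yields a projection-cost preserving
sketch with error 5ε. -/
theorem stmt_13 {n d r : ℕ} {k : ℕ} (s : ℕ) (hs : 0 < s)
    (A : Matrix (Fin n) (Fin d) ℝ)
    (U : Matrix (Fin n) (Fin r) ℝ) (V : Matrix (Fin d) (Fin r) ℝ) (σ : Fin r → ℝ)
    (hU : Uᵀ * U = 1) (hV : Vᵀ * V = 1)
    (hσdec : ∀ i j : Fin r, i ≤ j → σ j ≤ σ i) (hσpos : ∀ i, 0 < σ i)
    (hA : A = U * Matrix.diagonal σ * Vᵀ) (hrank : A.rank = r)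
    (hk1 : 1 ≤ k) (hkr : k < r)
    (p : Fin n → ℝ)
    (hpdef : ∀ i, p i =
        1 / 2 * ((∑ j, (firstCols U k hkr.le i j) ^ 2) / k)
      + 1 / 2 * ((∑ j, ((A - U * truncDiag σ k * Vᵀ) i j) ^ 2)
          / frobNorm (A - U * truncDiag σ k * Vᵀ) ^ 2))
    (ε δ : ℝ) (hε0 : 0 < ε) (hε1 : ε < 1) (hδ0 : 0 < δ) (hδ1 : δ < 1)
    (hsbig : (s : ℝ) ≥ max ((1 + ε / 3) * (4 * k * Real.log (16 * (1 + k) / δ)) / ε ^ 2)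
        (8 * k / (δ * ε ^ 2))) :
    probOf p (fun (ω : Fin s → Fin n) =>
      ∀ X : Matrix (Fin d) (Fin (d - k)) ℝ, Xᵀ * X = 1 →
        |frobNorm (samplingMatrix p s ω * A * X) ^ 2 - frobNorm (A * X) ^ 2|
          ≤ 5 * ε * frobNorm (A * X) ^ 2)
    ≥ 1 - δ := by
  obtain ⟨hs1, hs2⟩ := max_le_iff.mp hsbig
  have hk0 : (0 : ℝ) < k := by exact_mod_cast hk1
  set B := firstCols U k hkr.le with hBdef
  set R := A - U * truncDiag σ k * Vᵀ with hRdef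
  have hR : R = U * diagonal (fun i : Fin r => if (i : ℕ) < k then 0 else σ i) * Vᵀ := by
    rw [hRdef, hA, sub_mul_truncDiag]
  have hB : Bᵀ * B = 1 := firstCols_transpose_mul_self hkr.le U hU
  have hBR : Bᵀ * R = 0 := by rw [hR]; exact firstCols_transpose_mul_tail hkr.le U V σ hU
  obtain ⟨C, hC⟩ : ∃ C : Matrix (Fin k) (Fin d) ℝ, B * C + R = A :=
    ⟨_, by rw [hBdef, firstCols_mul_eq hkr.le U V σ, hRdef, add_sub_cancel]⟩
  have hVrow : ∀ i, ∑ c, Vᵀ i c ^ 2 = 1 := by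
    intro i
    have h := congrFun (congrFun hV i) i
    simpa only [mul_apply, transpose_apply, one_apply_eq, ← sq] using h
  have hFσ : trace (Rᵀ * R) = ∑ i : Fin r, (if (i : ℕ) < k then 0 else σ i) ^ 2 := by
    rw [hR, trace_transpose_mul_self_svd U hU]
    simp only [hVrow, mul_one]
  have hF : 0 < trace (Rᵀ * R) := by
    rw [hFσ]
    refine Finset.sum_pos' (fun i _ => sq_nonneg _) ⟨⟨k, hkr⟩, Finset.mem_univ _, ?_⟩
    simpa using pow_pos (hσpos _) 2
  simp only [frobNorm_sq_s13] at hpdef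
  have hBn : ∀ i, 0 ≤ ∑ x, B i x ^ 2 := fun i => by positivity
  have hRn : ∀ i, 0 ≤ ∑ x, R i x ^ 2 := fun i => by positivity
  have hp : ∀ i, 0 ≤ p i := fun i => by
    rw [hpdef]
    have := hBn i
    have := hRn i
    positivity
  have hp1 : ∑ i, p i = 1 := by
    simp only [hpdef, Finset.sum_add_distrib, ← Finset.mul_sum, ← Finset.sum_div,
      ← trace_transpose_mul_self, hB, trace_one, Fintype.card_fin]
    rw [div_self hk0.ne', div_self hF.ne']
    norm_num
  have hBp : ∀ i, ∑ x, B i x ^ 2 ≤ 2 * k * p i := fun i => by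
    have h : 0 ≤ 2 * k * (1 / 2 * ((∑ x, R i x ^ 2) / trace (Rᵀ * R))) := by
      have := hRn i
      positivity
    have e : 2 * k * (1 / 2 * ((∑ x, B i x ^ 2) / k)) = ∑ x, B i x ^ 2 := by field_simp
    rw [hpdef, mul_add, e]
    linarith
  have hRp : ∀ i, ∑ x, R i x ^ 2 ≤ 2 * trace (Rᵀ * R) * p i := fun i => by
    have h : 0 ≤ 2 * trace (Rᵀ * R) * (1 / 2 * ((∑ x, B i x ^ 2) / k)) := by
      have := hBn i
      positivity
    have e : 2 * trace (Rᵀ * R) * (1 / 2 * ((∑ x, R i x ^ 2) / trace (Rᵀ * R))) =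
        ∑ x, R i x ^ 2 := by field_simp
    rw [hpdef, mul_add, e]
    linarith
  have hkd : k ≤ d := by
    have := A.rank_le_width
    omega
  have hdk : (d : ℝ) - (d - k : ℕ) = k := by rw [Nat.cast_sub hkd]; ring
  refine (one_sub_le_probOf_samplingError hs hk1 hp hp1 B R hB hF hBp hRp hε0 hε1 hδ0 hs1
    hs2).trans (probOf_mono hp ?_)
  rintro ω ⟨h1, h2, h3, h4⟩ X hX
  have hmin := trace_tail_le hkr U V hU hV hσdec hσpos X hX hdk
  rw [← hFσ, ← hA, ← hC] at hmin
  have h := abs_trace_projection_cost_le (samplingError p ω) (samplingError_transpose p ω) B C R hB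
    hBR X hX hε0.le hmin h1 h2 h3 (by simpa only [Fintype.card_fin, hdk] using h4)
  rw [hC] at h
  rwa [Matrix.mul_assoc, frobNorm_samplingMatrix_mul_sq_sub, frobNorm_sq_s13]
end
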